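/- There exists a constant c > 0 depending only on a, b and β such that the following holds: for every Lipschitz function V : closure(Ω) → ℝ with a ≤ V(x) ≤ b for all x and with Lipschitz constant ‖∇V‖_∞ ≤ a/(2(1+2^{2β})), and every classical solution u of problem (P) relative to V, one has ∫_Ω e^{u(x)} dx ≤ c. -/

import Mathlib

open MeasureTheory Real RealInnerProductSpace

noncomputable section

/-- The Euclidean plane ℝ². -/
abbrev E2 := EuclideanSpace ℝ (Fin 2)

/-- The open annulus `{x : R₂ < |x| < R₁}` centered at the origin. -/
def ann (R₂ R₁ : ℝ) : Set E2 := {x : E2 | R₂ < ‖x‖ ∧ ‖x‖ < R₁}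

/-- `Ω`, the open annulus of radii 1/2 and 1 centered at the origin. -/
def Omega : Set E2 := ann (1/2) 1

/-- The Laplacian `Δ = ∂₁₁ + ∂₂₂` on ℝ². -/
def lap (u : E2 → ℝ) (x : E2) : ℝ :=
  ∑ i : Fin 2,
    iteratedFDeriv ℝ 2 u x ![EuclideanSpace.single i 1, EuclideanSpace.single i 1]

/-- The point `r (cos θ, sin θ)` on the circle of radius `r`. -/
def circlePt (r θ : ℝ) : E2 :=
  (WithLp.equiv 2 (Fin 2 → ℝ)).symm ![r * Real.cos θ, r * Real.sin θ]

/-- Arc-length integral of `f` over the circle `C(r) = {x : |x| = r}` centered at the origin: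
`∫_{C(r)} f dσ = ∫_0^{2π} f(r cos θ, r sin θ) r dθ`. -/
def circleIntR (f : E2 → ℝ) (r : ℝ) : ℝ := ∫ θ in (0:ℝ)..(2 * π), f (circlePt r θ) * r

/-- A classical solution of problem (P): `u ∈ C²(closure Ω)`, `u = 0` on `∂Ω`, and
`-Δu = (1 + |x - x₀|^{2β}) V e^u` in `Ω`. -/
def IsSolP (β : ℝ) (x₀ : E2) (V u : E2 → ℝ) : Prop :=
  ContDiffOn ℝ 2 u (closure Omega) ∧
  (∀ x ∈ frontier Omega, u x = 0) ∧
  ∀ x ∈ Omega, -lap u x = (1 + ‖x - x₀‖ ^ (2 * β)) * V x * Real.exp (u x)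

/-- A classical solution of problem (P_β): `u ∈ C²(closure Ω)`, `u = 0` on `∂Ω`, and
`-Δu = |x - x₀|^{2β} V e^u` in `Ω`. -/
def IsSolPbeta (β : ℝ) (x₀ : E2) (V u : E2 → ℝ) : Prop :=
  ContDiffOn ℝ 2 u (closure Omega) ∧
  (∀ x ∈ frontier Omega, u x = 0) ∧
  ∀ x ∈ Omega, -lap u x = ‖x - x₀‖ ^ (2 * β) * V x * Real.exp (u x)

lemma kernel_cx (z : ℂ) (ρ : ℝ) (hz : ‖z‖ ≤ ρ) (hρ : ρ < 1) (n : ℕ) :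
    -(ρ ^ (n+1) / (1 - ρ)) ≤ 1/2 + (∑ j ∈ Finset.range n, z ^ (j+1)).re := by
  have h1 : (1 - z) ≠ 0 := by
    intro h
    have : z = 1 := by linear_combination -h
    rw [this] at hz; simp at hz; linarith
  have h0 : 0 ≤ ρ := (norm_nonneg _).trans hz
  have hs : (1/2 : ℂ) + ∑ j ∈ Finset.range n, z ^ (j+1)
      = (1 + z) / (1 - z) / 2 - z ^ (n+1) / (1 - z) := by
    have h2 : (∑ j ∈ Finset.range n, z ^ j) * (1 - z) = 1 - z ^ n := geom_sum_mul_neg z n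
    have h3 : ∑ j ∈ Finset.range n, z ^ (j+1) = z * ∑ j ∈ Finset.range n, z ^ j := by
      rw [Finset.mul_sum]; exact Finset.sum_congr rfl (fun j _ => by ring)
    rw [h3]; field_simp
    linear_combination (2 * z) * h2
  have hs' := congrArg Complex.re hs
  rw [Complex.add_re, Complex.sub_re] at hs'
  have e1 : ((1/2 : ℂ)).re = 1/2 := by norm_num
  rw [e1] at hs'
  rw [hs']
  have p1 : 0 ≤ ((1 + z) / (1 - z) / 2).re := by
    have : ((1 + z) / (1 - z) / 2).re = (1 - Complex.normSq z) / Complex.normSq (1 - z) / 2 := by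
      rw [show ((1 + z) / (1 - z) / 2 : ℂ) = ((1 + z) / (1 - z)) / ((2:ℝ):ℂ) by norm_num,
        Complex.div_ofReal_re, Complex.div_re]
      simp [Complex.normSq_apply]; ring
    rw [this]
    have : Complex.normSq z ≤ 1 := by
      rw [Complex.normSq_eq_norm_sq]; nlinarith [norm_nonneg z]
    have h5 := Complex.normSq_nonneg (1 - z)
    apply div_nonneg _ (by norm_num)
    exact div_nonneg (by linarith) h5
  have p2 : (z ^ (n+1) / (1 - z)).re ≤ ρ ^ (n+1) / (1 - ρ) := by
    refine (Complex.re_le_norm _).trans ?_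
    rw [norm_div, norm_pow]
    have : 1 - ρ ≤ ‖1 - z‖ := by
      have := norm_sub_norm_le (1:ℂ) z
      simp at this; linarith
    gcongr
  linarith

lemma kernel_real (x φ ρ : ℝ) (hx0 : 0 ≤ x) (hx : x ≤ ρ) (hρ : ρ < 1) (n : ℕ) :
    -(1/2 + ρ ^ (n+1) / (1 - ρ)) ≤ ∑ j ∈ Finset.range n, x ^ (j+1) * cos (((j+1 : ℕ) : ℝ) * φ) := by
  have h := kernel_cx (x * Complex.exp (φ * Complex.I)) ρ (by
    rw [norm_mul, Complex.norm_exp_ofReal_mul_I]; simp [abs_of_nonneg hx0, hx]) hρ n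
  rw [Complex.re_sum] at h
  have : ∀ j : ℕ, (((x:ℂ) * Complex.exp (φ * Complex.I)) ^ (j+1)).re
      = x ^ (j+1) * cos (((j+1 : ℕ) : ℝ) * φ) := by
    intro j
    rw [mul_pow, ← Complex.exp_nat_mul, ← Complex.ofReal_pow, Complex.re_ofReal_mul]
    congr 1
    rw [show (((j+1:ℕ):ℂ) * ((φ:ℂ) * Complex.I)) = ((((j+1:ℕ):ℝ) * φ : ℝ) : ℂ) * Complex.I by
      push_cast; ring, Complex.exp_ofReal_mul_I_re]
  simp_rw [this] at h
  linarith

lemma pos_pair {X Y : Type*} [MeasurableSpace X] [MeasurableSpace Y] (ν : Measure X)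
    (ν' : Measure Y) (a r θ : X → ℝ) (b r' θ' : Y → ℝ)
    (ha : ∀ᵐ p ∂ν, 0 ≤ a p ∧ 0 ≤ r p ∧ r p ≤ 1)
    (hb : ∀ᵐ p ∂ν', 0 ≤ b p ∧ 0 ≤ r' p ∧ r' p ≤ 1)
    (ia : Integrable a ν) (ib : Integrable b ν')
    (iac : ∀ k : ℕ, Integrable (fun p => a p * (r p ^ k * cos (k * θ p))) ν)
    (ias : ∀ k : ℕ, Integrable (fun p => a p * (r p ^ k * sin (k * θ p))) ν)
    (ibc : ∀ k : ℕ, Integrable (fun p => b p * (r' p ^ k * cos (k * θ' p))) ν')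
    (ibs : ∀ k : ℕ, Integrable (fun p => b p * (r' p ^ k * sin (k * θ' p))) ν')
    (ρ : ℝ) (h0 : 0 ≤ ρ) (hρ : ρ < 1) (n : ℕ) :
    -((1/2 + ρ ^ (n+1) / (1 - ρ)) * ((∫ p, a p ∂ν) * (∫ p, b p ∂ν'))) ≤
    ∑ j ∈ Finset.range n, ρ ^ (j+1) *
      ((∫ p, a p * (r p ^ (j+1) * cos (((j+1 : ℕ) : ℝ) * θ p)) ∂ν)
        * (∫ p, b p * (r' p ^ (j+1) * cos (((j+1 : ℕ) : ℝ) * θ' p)) ∂ν')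
      + (∫ p, a p * (r p ^ (j+1) * sin (((j+1 : ℕ) : ℝ) * θ p)) ∂ν)
        * (∫ p, b p * (r' p ^ (j+1) * sin (((j+1 : ℕ) : ℝ) * θ' p)) ∂ν')) := by
  set c := (1/2 + ρ ^ (n+1) / (1 - ρ)) with hc
  set Ac : ℕ → ℝ := fun k => ∫ p, a p * (r p ^ k * cos (k * θ p)) ∂ν with hAc
  set As : ℕ → ℝ := fun k => ∫ p, a p * (r p ^ k * sin (k * θ p)) ∂ν with hAs
  -- inner inequality
  have inner : ∀ᵐ q ∂ν', -(c * ∫ p, a p ∂ν) ≤ ∑ j ∈ Finset.range n, ρ ^ (j+1) *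
      (Ac (j+1) * (r' q ^ (j+1) * cos (((j+1 : ℕ) : ℝ) * θ' q))
        + As (j+1) * (r' q ^ (j+1) * sin (((j+1 : ℕ) : ℝ) * θ' q))) := by
    filter_upwards [hb] with q hq
    have e : ∑ j ∈ Finset.range n, ρ ^ (j+1) *
      (Ac (j+1) * (r' q ^ (j+1) * cos (((j+1 : ℕ) : ℝ) * θ' q))
        + As (j+1) * (r' q ^ (j+1) * sin (((j+1 : ℕ) : ℝ) * θ' q)))
        = ∫ p, ∑ j ∈ Finset.range n, ((ρ ^ (j+1) * (r' q ^ (j+1) * cos (((j+1 : ℕ) : ℝ) * θ' q))) *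
          (a p * (r p ^ (j+1) * cos (((j+1 : ℕ) : ℝ) * θ p)))
          + (ρ ^ (j+1) * (r' q ^ (j+1) * sin (((j+1 : ℕ) : ℝ) * θ' q))) *
          (a p * (r p ^ (j+1) * sin (((j+1 : ℕ) : ℝ) * θ p)))) ∂ν := by
      rw [integral_finsetSum]
      · refine Finset.sum_congr rfl (fun j _ => ?_)
        rw [integral_add ((iac (j+1)).const_mul _) ((ias (j+1)).const_mul _),
          integral_const_mul, integral_const_mul]
        simp only [hAc, hAs]
        ring
      · intro j _
        exact ((iac (j+1)).const_mul _).add ((ias (j+1)).const_mul _)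
    rw [e, ← integral_const_mul, ← integral_neg]
    apply integral_mono_ae
    · exact (ia.const_mul _).neg
    · apply integrable_finsetSum
      intro j _
      exact ((iac (j+1)).const_mul _).add ((ias (j+1)).const_mul _)
    · filter_upwards [ha] with p hp
      have hk := kernel_real (ρ * r p * r' q) (θ p - θ' q) ρ
        (mul_nonneg (mul_nonneg h0 hp.2.1) hq.2.1) (by
          have : r p * r' q ≤ 1 := mul_le_one₀ hp.2.2 hq.2.1 hq.2.2
          nlinarith) hρ n
      have := mul_le_mul_of_nonneg_left hk hp.1
      calc -(c * a p) = a p * -(1/2 + ρ ^ (n+1) / (1 - ρ)) := by rw [hc]; ring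
        _ ≤ _ := this
        _ = _ := by
          rw [Finset.mul_sum]
          refine Finset.sum_congr rfl (fun j _ => ?_)
          rw [mul_sub, cos_sub, mul_pow, mul_pow]; ring
  have e2 : ∑ j ∈ Finset.range n, ρ ^ (j+1) *
      (Ac (j+1) * (∫ p, b p * (r' p ^ (j+1) * cos (((j+1 : ℕ) : ℝ) * θ' p)) ∂ν')
      + As (j+1) * (∫ p, b p * (r' p ^ (j+1) * sin (((j+1 : ℕ) : ℝ) * θ' p)) ∂ν'))
      = ∫ q, ∑ j ∈ Finset.range n, ((ρ ^ (j+1) * Ac (j+1)) *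
          (b q * (r' q ^ (j+1) * cos (((j+1 : ℕ) : ℝ) * θ' q)))
          + (ρ ^ (j+1) * As (j+1)) *
          (b q * (r' q ^ (j+1) * sin (((j+1 : ℕ) : ℝ) * θ' q)))) ∂ν' := by
      rw [integral_finsetSum]
      · refine Finset.sum_congr rfl (fun j _ => ?_)
        rw [integral_add ((ibc (j+1)).const_mul _) ((ibs (j+1)).const_mul _),
          integral_const_mul, integral_const_mul]
        ring
      · intro j _
        exact ((ibc (j+1)).const_mul _).add ((ibs (j+1)).const_mul _)
  change _ ≤ ∑ j ∈ Finset.range n, ρ ^ (j+1) *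
      (Ac (j+1) * (∫ p, b p * (r' p ^ (j+1) * cos (((j+1 : ℕ) : ℝ) * θ' p)) ∂ν')
      + As (j+1) * (∫ p, b p * (r' p ^ (j+1) * sin (((j+1 : ℕ) : ℝ) * θ' p)) ∂ν'))
  rw [e2, ← mul_assoc, ← integral_const_mul, ← integral_neg]
  apply integral_mono_ae
  · exact (ib.const_mul _).neg
  · apply integrable_finsetSum
    intro j _
    exact ((ibc (j+1)).const_mul _).add ((ibs (j+1)).const_mul _)
  · filter_upwards [hb, inner] with q hq hi
    have := mul_le_mul_of_nonneg_left hi hq.1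
    calc -(c * (∫ p, a p ∂ν) * b q) = b q * -(c * ∫ p, a p ∂ν) := by ring
      _ ≤ _ := this
      _ = _ := by
          rw [Finset.mul_sum]
          refine Finset.sum_congr rfl (fun j _ => ?_)
          ring

lemma parseval_real (f : ℝ → ℝ) (hf : Continuous f) :
    HasSum (fun j : ℕ => (∫ x in (0:ℝ)..(2*π), f x * cos (((j+1:ℕ):ℝ) * x)) ^ 2
      + (∫ x in (0:ℝ)..(2*π), f x * sin (((j+1:ℕ):ℝ) * x)) ^ 2)
      (π * (∫ x in (0:ℝ)..(2*π), f x ^ 2) - (∫ x in (0:ℝ)..(2*π), f x) ^ 2 / 2) := by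
  have hpi := Real.pi_pos
  have hab : (0:ℝ) < 2 * π := by positivity
  have hL2 : MemLp (fun x => (f x : ℂ)) 2 (volume.restrict (Set.Ioc 0 (2*π))) := by
    have hc : Continuous (fun x => (f x : ℂ)) := Complex.continuous_ofReal.comp hf
    obtain ⟨C, hC⟩ := (isCompact_Icc (a := (0:ℝ)) (b := 2*π)).exists_bound_of_continuousOn
      hc.continuousOn
    apply MemLp.of_bound hc.aestronglyMeasurable C
    filter_upwards [ae_restrict_mem measurableSet_Ioc] with x hx
    exact hC x (Set.Ioc_subset_Icc_self hx)
  have H := hasSum_sq_fourierCoeffOn hab hL2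
  have key : ∀ k : ℤ, ‖fourierCoeffOn hab (fun x => (f x : ℂ)) k‖ ^ 2
      = ((∫ x in (0:ℝ)..(2*π), f x * cos (k * x)) ^ 2
        + (∫ x in (0:ℝ)..(2*π), f x * sin (k * x)) ^ 2) / (4 * π ^ 2) := by
    intro k
    rw [fourierCoeffOn_eq_integral]
    have e : ∫ x in (0:ℝ)..(2*π), fourier (-k) (x : AddCircle (2*π - 0)) • (f x : ℂ)
       = ((∫ x in (0:ℝ)..(2*π), f x * cos (k * x) : ℝ) : ℂ)
        - ((∫ x in (0:ℝ)..(2*π), f x * sin (k * x) : ℝ) : ℂ) * Complex.I := by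
      rw [← intervalIntegral.integral_ofReal, ← intervalIntegral.integral_ofReal,
        ← intervalIntegral.integral_mul_const, ← intervalIntegral.integral_sub]
      · apply intervalIntegral.integral_congr
        intro x _
        simp only [fourier_coe_apply]
        have : (2 * (π:ℂ) * Complex.I * ((-k : ℤ) : ℂ) * (x:ℂ) / ((2 * π - 0 : ℝ) : ℂ))
            = ((-(k * x) : ℝ) : ℂ) * Complex.I := by
          have : (π : ℂ) ≠ 0 := by exact_mod_cast hpi.ne'
          push_cast; field_simp; ring
        rw [this, Complex.exp_mul_I, ← Complex.ofReal_cos, ← Complex.ofReal_sin, cos_neg, sin_neg]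
        simp only [smul_eq_mul]; push_cast; ring
      · apply Continuous.intervalIntegrable; fun_prop
      · apply Continuous.intervalIntegrable; fun_prop
    rw [e, norm_smul, mul_pow, ← Complex.normSq_eq_norm_sq, Complex.normSq_apply]
    simp [abs_of_pos hpi]
    field_simp
    ring
  simp_rw [key] at H
  have H2 := H.nat_add_neg
  have H3 := (hasSum_nat_add_iff' 1).2 H2
  have H4 := H3.mul_left (2 * π ^ 2)
  refine (congrArg₂ (fun (u : ℕ → ℝ) (v : ℝ) => HasSum u v) ?_ ?_).mp H4
  · symm
    funext j
    have c1 : ∀ x : ℝ, cos (((-((j+1:ℕ):ℤ) : ℤ) : ℝ) * x) = cos (((j+1:ℕ):ℝ) * x) := by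
      intro x; push_cast; rw [show -((j:ℝ)+1) * x = -(((j:ℝ)+1) * x) by ring, cos_neg]
    have c2 : ∀ x : ℝ, sin (((-((j+1:ℕ):ℤ) : ℤ) : ℝ) * x) = - sin (((j+1:ℕ):ℝ) * x) := by
      intro x; push_cast; rw [show -((j:ℝ)+1) * x = -(((j:ℝ)+1) * x) by ring, sin_neg]
    simp only [c1, c2, mul_neg, intervalIntegral.integral_neg, Int.cast_natCast]
    field_simp
    ring
  · simp
    field_simp
    ring

lemma abel_bound (p : ℕ → ℝ) (S C : ℝ) (D : ℝ) (hS : HasSum p S)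
    (h : ∀ ρ : ℝ, 0 < ρ → ρ < 1 → ∀ n : ℕ,
      ∑ j ∈ Finset.range n, ρ ^ (j+1) * p j ≤ C + D * (ρ ^ (n+1) / (1 - ρ))) : S ≤ C := by
  have h1 := Real.tendsto_tsum_powerSeries_nhdsWithin_lt hS.tendsto_sum_nat
  have h2 : Filter.Tendsto (fun x : ℝ => x * ∑' n, p n * x ^ n) (nhdsWithin 1 (Set.Iio 1))
      (nhds (1 * S)) :=
    ((continuous_id.tendsto (1:ℝ)).mono_left nhdsWithin_le_nhds).mul h1
  rw [one_mul] at h2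
  refine le_of_tendsto h2 ?_
  have : Set.Ioo (0:ℝ) 1 ∈ nhdsWithin (1:ℝ) (Set.Iio 1) := Ioo_mem_nhdsLT (by norm_num)
  filter_upwards [this] with ρ hρ
  have sm : Summable (fun n => p n * ρ ^ n) := by
    have hb : ∃ B, ∀ n, ‖p n‖ ≤ B := by
      have := hS.summable.tendsto_atTop_zero.norm.bddAbove_range
      obtain ⟨B, hB⟩ := this
      exact ⟨B, fun n => hB ⟨n, rfl⟩⟩
    obtain ⟨B, hB⟩ := hb
    refine Summable.of_norm_bounded (g := fun n => B * ρ ^ n)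
      ((summable_geometric_of_lt_one hρ.1.le hρ.2).mul_left B) (fun n => ?_)
    rw [norm_mul, norm_pow, Real.norm_of_nonneg hρ.1.le]
    exact mul_le_mul_of_nonneg_right (hB n) (pow_nonneg hρ.1.le _)
  have t1 := (sm.hasSum.mul_left ρ).tendsto_sum_nat
  have t2 : Filter.Tendsto (fun n : ℕ => C + D * (ρ ^ (n+1) / (1 - ρ))) Filter.atTop
      (nhds (C + D * (0 / (1 - ρ)))) := by
    have := (tendsto_pow_atTop_nhds_zero_of_lt_one hρ.1.le hρ.2)
    have := (Filter.tendsto_add_atTop_iff_nat 1).2 this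
    exact ((this.div_const _).const_mul D).const_add C
  simp only [zero_div, mul_zero, add_zero] at t2
  refine le_of_tendsto_of_tendsto' t1 t2 (fun n => ?_)
  refine le_trans (le_of_eq ?_) (h ρ hρ.1 hρ.2 n)
  exact Finset.sum_congr rfl (fun j _ => by ring)

/-- Stieltjes-type inequality. -/
lemma stieltjes (K g g' : ℝ → ℝ) (s t : ℝ) (hst : s ≤ t)
    (hK : ContinuousOn K (Set.Icc s t)) (mK : MonotoneOn K (Set.Icc s t))
    (hg : ContinuousOn g (Set.Icc s t)) (hg' : ContinuousOn g' (Set.Icc s t))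
    (dg : ∀ x ∈ Set.Ioo s t, HasDerivAt g (g' x) x) (pg : ∀ x ∈ Set.Icc s t, 0 < g x) :
    ∫ x in s..t, K x * g' x ≤ K t * g t - K s * g s := by
  obtain ⟨B, hB⟩ := isCompact_Icc.exists_bound_of_continuousOn hg'
  obtain ⟨m, hm, hmin⟩ := isCompact_Icc.exists_isMinOn (Set.nonempty_Icc.2 hst) hg
  have hgm := pg m hm
  have hmin' : ∀ x ∈ Set.Icc s t, g m ≤ g x := fun x hx => hmin hx
  have hKg : ContinuousOn (fun x => K x * g' x) (Set.Icc s t) := hK.mul hg'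
  have ii : ∀ (f : ℝ → ℝ), ContinuousOn f (Set.Icc s t) → ∀ x y, s ≤ x → x ≤ y → y ≤ t →
      IntervalIntegrable f volume x y := by
    intro f hf x y h1 h2 h3
    apply ContinuousOn.intervalIntegrable
    rw [Set.uIcc_of_le h2]
    exact hf.mono (Set.Icc_subset_Icc h1 h3)
  have B0 : 0 ≤ B := (norm_nonneg _).trans (hB s (Set.left_mem_Icc.2 hst))
  -- local step
  have step : ∀ x y, s ≤ x → x ≤ y → y ≤ t → B * (y - x) ≤ g m →
      ∫ z in x..y, K z * g' z ≤ K y * g y - K x * g x := by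
    intro x y h1 h2 h3 h4
    have hx : x ∈ Set.Icc s t := ⟨h1, h2.trans h3⟩
    have hy : y ∈ Set.Icc s t := ⟨h1.trans h2, h3⟩
    have ftc : ∫ z in x..y, g' z = g y - g x := by
      apply intervalIntegral.integral_eq_sub_of_hasDerivAt_of_le h2
      · exact hg.mono (Set.Icc_subset_Icc h1 h3)
      · intro z hz; exact dg z ⟨h1.trans_lt hz.1, hz.2.trans_le h3⟩
      · exact ii g' hg' x y h1 h2 h3
    have e1 : ∫ z in x..y, K z * g' z = (∫ z in x..y, (K z - K x) * g' z) + K x * (g y - g x) := by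
      rw [← ftc, ← intervalIntegral.integral_const_mul, ← intervalIntegral.integral_add]
      · congr 1; funext z; ring
      · exact ii _ ((hK.sub continuousOn_const).mul hg') x y h1 h2 h3
      · exact ii _ (continuousOn_const.mul hg') x y h1 h2 h3
    have e2 : ∫ z in x..y, (K z - K x) * g' z ≤ ∫ z in x..y, (K y - K x) * B := by
      apply intervalIntegral.integral_mono_on h2
      · exact ii _ ((hK.sub continuousOn_const).mul hg') x y h1 h2 h3
      · exact intervalIntegrable_const
      · intro z hz
        have hz' : z ∈ Set.Icc s t := ⟨h1.trans hz.1, hz.2.trans h3⟩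
        have a1 := mK hx hz' hz.1
        have a2 := mK hz' hy hz.2
        have a3 := hB z hz'
        rw [Real.norm_eq_abs] at a3
        have a4 := le_of_abs_le a3
        nlinarith
    rw [intervalIntegral.integral_const, smul_eq_mul] at e2
    have a5 := mK hx hy h2
    have a6 := hmin' y hy
    rw [e1]
    nlinarith [mul_nonneg (sub_nonneg.2 a5) (sub_nonneg.2 (h4.trans a6))]
  obtain ⟨N, hN⟩ := exists_nat_gt (B * (t - s) / g m)
  have hN0 : 0 < N := by
    rcases Nat.eq_zero_or_pos N with h | h
    · subst h
      have : 0 ≤ B * (t - s) / g m := div_nonneg (mul_nonneg B0 (sub_nonneg.2 hst)) hgm.le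
      simp at hN; linarith
    · exact h
  have hNr : (0:ℝ) < N := by exact_mod_cast hN0
  have hNB : B * ((t - s) / N) ≤ g m := by
    rw [div_lt_iff₀ hgm] at hN
    rw [← mul_div_assoc, div_le_iff₀ hNr]; linarith
  set h := (t - s) / N with hh
  have h0 : 0 ≤ h := div_nonneg (sub_nonneg.2 hst) hNr.le
  have hNh : (N:ℝ) * h = t - s := by rw [hh]; field_simp
  have ind : ∀ i : ℕ, i ≤ N → ∫ z in s..(s + i * h), K z * g' z
      ≤ K (s + i * h) * g (s + i * h) - K s * g s := by
    intro i
    induction i with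
    | zero => intro _; simp
    | succ i ih =>
      intro hi
      have hi' : ((i:ℝ) + 1) ≤ N := by exact_mod_cast hi
      have ihh := ih (by omega)
      have q0 : 0 ≤ (i:ℝ) * h := by positivity
      have q1 : s + ((i+1:ℕ):ℝ) * h = s + i * h + h := by push_cast; ring
      have q2 : s + i * h + h ≤ t := by nlinarith
      rw [q1]
      have st := step (s + i * h) (s + i * h + h) (by linarith) (by linarith) q2 (by
        rw [add_sub_cancel_left]; exact hNB)
      rw [← intervalIntegral.integral_add_adjacent_intervals
        (ii _ hKg s (s + i*h) le_rfl (by linarith) (by linarith))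
        (ii _ hKg (s + i*h) (s + i*h + h) (by linarith) (by linarith) q2)]
      linarith
  have := ind N le_rfl
  rw [hNh] at this
  simpa using this

/-- box in the (t, θ) cylinder -/
def bx (t₁ t₂ : ℝ) : Set (ℝ × ℝ) := Set.Icc t₁ t₂ ×ˢ Set.Icc 0 (2 * π)

/-- a strip -/
def strip (L : ℝ) : Set (ℝ × ℝ) := Set.Icc 0 L ×ˢ Set.univ

lemma bx_compact (t₁ t₂ : ℝ) : IsCompact (bx t₁ t₂) := isCompact_Icc.prod isCompact_Icc
lemma bx_meas (t₁ t₂ : ℝ) : MeasurableSet (bx t₁ t₂) := measurableSet_Icc.prod measurableSet_Icc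
lemma bx_sub {L t₁ t₂ : ℝ} (h1 : 0 ≤ t₁) (h2 : t₂ ≤ L) : bx t₁ t₂ ⊆ strip L :=
  fun _ hp => ⟨⟨h1.trans hp.1.1, hp.1.2.trans h2⟩, trivial⟩
lemma bx_mono {s₁ s₂ t₁ t₂ : ℝ} (h1 : s₁ ≤ t₁) (h2 : t₂ ≤ s₂) : bx t₁ t₂ ⊆ bx s₁ s₂ :=
  fun _ hp => ⟨⟨h1.trans hp.1.1, hp.1.2.trans h2⟩, hp.2⟩
lemma bx_int {t₁ t₂ : ℝ} {F : ℝ × ℝ → ℝ} (h : ContinuousOn F (bx t₁ t₂)) :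
    IntegrableOn F (bx t₁ t₂) := h.integrableOn_compact (bx_compact _ _)

lemma div_box (f g F : ℝ × ℝ → ℝ) (t₁ t₂ : ℝ) (h12 : t₁ ≤ t₂)
    (cf : ContinuousOn f (bx t₁ t₂)) (cg : ContinuousOn g (bx t₁ t₂))
    (cF : ContinuousOn F (bx t₁ t₂))
    (h : ∀ p : ℝ × ℝ, p.1 ∈ Set.Ioo t₁ t₂ → ∃ f' g' : ℝ × ℝ →L[ℝ] ℝ, HasFDerivAt f f' p ∧
      HasFDerivAt g g' p ∧ f' (1,0) + g' (0,1) = F p)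
    (per : ∀ t ∈ Set.Icc t₁ t₂, g (t, 2*π) = g (t, 0)) :
    ∫ p in bx t₁ t₂, F p = (∫ θ in (0:ℝ)..(2*π), f (t₂, θ)) - ∫ θ in (0:ℝ)..(2*π), f (t₁, θ) := by
  classical
  have hpi := Real.pi_pos
  have key := integral_divergence_prod_Icc_of_hasFDerivAt_off_countable_of_le f g
    (fun p => if p.1 ∈ Set.Ioo t₁ t₂ then fderiv ℝ f p else F p • ContinuousLinearMap.fst ℝ ℝ ℝ)
    (fun p => if p.1 ∈ Set.Ioo t₁ t₂ then fderiv ℝ g p else 0)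
    (t₁, 0) (t₂, 2*π) ⟨h12, by positivity⟩ ∅ Set.countable_empty
    (by rw [← Set.Icc_prod_Icc]; exact cf) (by rw [← Set.Icc_prod_Icc]; exact cg)
    (by
      intro p hp
      have hp1 : p.1 ∈ Set.Ioo t₁ t₂ := hp.1.1
      obtain ⟨f', g', hf, hg, -⟩ := h p hp1
      simp only [hp1, if_true]
      rw [hf.fderiv]; exact hf)
    (by
      intro p hp
      have hp1 : p.1 ∈ Set.Ioo t₁ t₂ := hp.1.1
      obtain ⟨f', g', hf, hg, -⟩ := h p hp1
      simp only [hp1, if_true]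
      rw [hg.fderiv]; exact hg)
  have eF : (fun p : ℝ × ℝ => (if p.1 ∈ Set.Ioo t₁ t₂ then fderiv ℝ f p else F p • ContinuousLinearMap.fst ℝ ℝ ℝ) (1,0)
      + (if p.1 ∈ Set.Ioo t₁ t₂ then fderiv ℝ g p else 0) (0,1)) = F := by
    funext p
    by_cases hp1 : p.1 ∈ Set.Ioo t₁ t₂
    · obtain ⟨f', g', hf, hg, he⟩ := h p hp1
      simp only [hp1, if_true]
      rw [hf.fderiv, hg.fderiv]; exact he
    · simp only [hp1, if_false]
      simp
  rw [eF] at key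
  rw [← Set.Icc_prod_Icc] at key
  have key := key (bx_int cF)
  change ∫ p in bx t₁ t₂, F p = _ at key
  rw [key]
  have : ∫ x in t₁..t₂, g (x, 2*π) = ∫ x in t₁..t₂, g (x, 0) := by
    apply intervalIntegral.integral_congr
    intro x hx
    rw [Set.uIcc_of_le h12] at hx
    exact per x hx
  simp only [this]
  ring

structure Cyl (L k0 C1 : ℝ) (U Ut Uh K : ℝ × ℝ → ℝ) : Prop where
  hL : 0 < L
  hk : 0 < k0
  cU : ContinuousOn U (strip L)
  ct : ContinuousOn Ut (strip L)
  ch : ContinuousOn Uh (strip L)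
  cK : ContinuousOn K (strip L)
  dU : ∀ p : ℝ × ℝ, p.1 ∈ Set.Ioo 0 L →
    HasFDerivAt U (Ut p • ContinuousLinearMap.fst ℝ ℝ ℝ + Uh p • ContinuousLinearMap.snd ℝ ℝ ℝ) p
  d2 : ∀ p : ℝ × ℝ, p.1 ∈ Set.Ioo 0 L → ∃ A B C : ℝ,
    HasFDerivAt Ut (A • ContinuousLinearMap.fst ℝ ℝ ℝ + B • ContinuousLinearMap.snd ℝ ℝ ℝ) p ∧
    HasFDerivAt Uh (B • ContinuousLinearMap.fst ℝ ℝ ℝ + C • ContinuousLinearMap.snd ℝ ℝ ℝ) p ∧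
    A + C = -(K p * exp (U p))
  U0 : ∀ θ, U (0, θ) = 0
  UL : ∀ θ, U (L, θ) = 0
  h0 : ∀ θ, Uh (0, θ) = 0
  hhL : ∀ θ, Uh (L, θ) = 0
  pU : ∀ t ∈ Set.Icc 0 L, ∀ θ, U (t, θ + 2*π) = U (t, θ)
  pt : ∀ t ∈ Set.Icc 0 L, ∀ θ, Ut (t, θ + 2*π) = Ut (t, θ)
  ph : ∀ t ∈ Set.Icc 0 L, ∀ θ, Uh (t, θ + 2*π) = Uh (t, θ)
  kK : ∀ p ∈ strip L, k0 ≤ K p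
  mK : ∀ θ, MonotoneOn (fun t => K (t, θ)) (Set.Icc 0 L)
  aK : ∀ θ s t, L/3 ≤ s → s ≤ t → t ≤ L → K (t, θ) ≤ exp (C1 * (t - s)) * K (s, θ)

lemma dslice1 {F : ℝ × ℝ → ℝ} {A B t θ : ℝ}
    (h : HasFDerivAt F (A • ContinuousLinearMap.fst ℝ ℝ ℝ + B • ContinuousLinearMap.snd ℝ ℝ ℝ) (t, θ)) :
    HasDerivAt (fun s => F (s, θ)) A t := by
  have h1 : HasDerivAt (fun s : ℝ => ((s, θ) : ℝ × ℝ)) (1, 0) t :=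
    (hasDerivAt_id t).prodMk (hasDerivAt_const t θ)
  exact (h.comp_hasDerivAt t h1).congr_deriv (by simp)

lemma dslice2 {F : ℝ × ℝ → ℝ} {A B t θ : ℝ}
    (h : HasFDerivAt F (A • ContinuousLinearMap.fst ℝ ℝ ℝ + B • ContinuousLinearMap.snd ℝ ℝ ℝ) (t, θ)) :
    HasDerivAt (fun s => F (t, s)) B θ := by
  have h1 : HasDerivAt (fun s : ℝ => ((t, s) : ℝ × ℝ)) (0, 1) θ :=
    (hasDerivAt_const θ t).prodMk (hasDerivAt_id θ)
  exact (h.comp_hasDerivAt θ h1).congr_deriv (by simp)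

namespace Cyl
variable {L k0 C1 : ℝ} {U Ut Uh K : ℝ × ℝ → ℝ}

lemma cμ (h : Cyl L k0 C1 U Ut Uh K) : ContinuousOn (fun p => K p * exp (U p)) (strip L) :=
  h.cK.mul (continuous_exp.comp_continuousOn h.cU)

lemma μpos (h : Cyl L k0 C1 U Ut Uh K) (p : ℝ × ℝ) (hp : p ∈ strip L) : 0 < K p * exp (U p) :=
  mul_pos (h.hk.trans_le (h.kK p hp)) (exp_pos _)

lemma slice (h : Cyl L k0 C1 U Ut Uh K) {F : ℝ × ℝ → ℝ} (hF : ContinuousOn F (strip L)) (t : ℝ)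
    (ht : t ∈ Set.Icc 0 L) : Continuous (fun θ => F (t, θ)) := by
  rw [← continuousOn_univ]
  exact hF.comp (by fun_prop) (fun θ _ => ⟨ht, trivial⟩)

lemma slice' (h : Cyl L k0 C1 U Ut Uh K) {F : ℝ × ℝ → ℝ} (hF : ContinuousOn F (strip L)) (θ : ℝ) :
    ContinuousOn (fun t => F (t, θ)) (Set.Icc 0 L) :=
  hF.comp (by fun_prop) (fun t ht => ⟨ht, trivial⟩)

lemma green (h : Cyl L k0 C1 U Ut Uh K) (α α' α'' γ γ' : ℝ → ℝ) (κ t₁ t₂ : ℝ)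
    (h1 : 0 ≤ t₁) (h12 : t₁ ≤ t₂) (h2 : t₂ ≤ L)
    (dα : ∀ t, HasDerivAt α (α' t) t) (dα' : ∀ t, HasDerivAt α' (α'' t) t) (cα'' : Continuous α'')
    (dγ : ∀ t, HasDerivAt γ (γ' t) t) (dγ' : ∀ t, HasDerivAt γ' (-κ * γ t) t)
    (pγ : γ (2*π) = γ 0) (pγ' : γ' (2*π) = γ' 0) :
    (∫ θ in (0:ℝ)..(2*π), (α t₂ * Ut (t₂, θ) - α' t₂ * U (t₂, θ)) * γ θ)
      - (∫ θ in (0:ℝ)..(2*π), (α t₁ * Ut (t₁, θ) - α' t₁ * U (t₁, θ)) * γ θ)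
    = - (∫ p in bx t₁ t₂, α p.1 * γ p.2 * (K p * exp (U p)))
      - ∫ p in bx t₁ t₂, (α'' p.1 - κ * α p.1) * γ p.2 * U p := by
  have cα : Continuous α := continuous_iff_continuousAt.2 fun t => (dα t).continuousAt
  have cα' : Continuous α' := continuous_iff_continuousAt.2 fun t => (dα' t).continuousAt
  have cγ : Continuous γ := continuous_iff_continuousAt.2 fun t => (dγ t).continuousAt
  have cγ' : Continuous γ' := continuous_iff_continuousAt.2 fun t => (dγ' t).continuousAt
  have hs := bx_sub h1 h2
  have cU := h.cU.mono hs
  have ct := h.ct.mono hs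
  have ch := h.ch.mono hs
  have cμ := h.cμ.mono hs
  have c1 : ContinuousOn (fun p : ℝ × ℝ => α p.1 * γ p.2 * (K p * exp (U p))) (bx t₁ t₂) :=
    ContinuousOn.mul (by fun_prop) cμ
  have c2 : ContinuousOn (fun p : ℝ × ℝ => (α'' p.1 - κ * α p.1) * γ p.2 * U p) (bx t₁ t₂) :=
    ContinuousOn.mul (by fun_prop) cU
  have key := div_box (fun p => (α p.1 * Ut p - α' p.1 * U p) * γ p.2)
    (fun p => α p.1 * (γ p.2 * Uh p - γ' p.2 * U p))
    (fun p => -(α p.1 * γ p.2 * (K p * exp (U p))) - (α'' p.1 - κ * α p.1) * γ p.2 * U p)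
    t₁ t₂ h12
    (((ContinuousOn.mul (by fun_prop) ct).sub (ContinuousOn.mul (by fun_prop) cU)).mul (by fun_prop))
    (ContinuousOn.mul (by fun_prop) ((ContinuousOn.mul (by fun_prop) ch).sub
      (ContinuousOn.mul (by fun_prop) cU)))
    (c1.neg.sub c2)
    (by
      intro p hp
      have hp' : p.1 ∈ Set.Ioo 0 L := ⟨h1.trans_lt hp.1, hp.2.trans_le h2⟩
      obtain ⟨A, B, C, hA, hC, hAC⟩ := h.d2 p hp'
      have hU := h.dU p hp'
      have ea := (dα p.1).comp_hasFDerivAt p (hasFDerivAt_fst (𝕜 := ℝ) (E := ℝ) (F := ℝ) (p := p))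
      have ea' := (dα' p.1).comp_hasFDerivAt p (hasFDerivAt_fst (𝕜 := ℝ) (E := ℝ) (F := ℝ) (p := p))
      have eg := (dγ p.2).comp_hasFDerivAt p (hasFDerivAt_snd (𝕜 := ℝ) (E := ℝ) (F := ℝ) (p := p))
      have eg' := (dγ' p.2).comp_hasFDerivAt p (hasFDerivAt_snd (𝕜 := ℝ) (E := ℝ) (F := ℝ) (p := p))
      refine ⟨_, _, ((ea.mul hA).sub (ea'.mul hU)).mul eg,
        ea.mul ((eg.mul hC).sub (eg'.mul hU)), ?_⟩
      simp
      linear_combination (α p.1 * γ p.2) * hAC)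
    (by
      intro t ht
      have ht' : t ∈ Set.Icc 0 L := ⟨h1.trans ht.1, ht.2.trans h2⟩
      have q1 := h.pU t ht' 0
      have q2 := h.ph t ht' 0
      rw [zero_add] at q1 q2
      simp only [q1, q2, pγ, pγ'])
  rw [← key, integral_sub, integral_neg]
  · exact (bx_int c1).neg
  · exact bx_int c2

lemma green0 (h : Cyl L k0 C1 U Ut Uh K) (α α' α'' : ℝ → ℝ) 
    (dα : ∀ t, HasDerivAt α (α' t) t) (dα' : ∀ t, HasDerivAt α' (α'' t) t) (cα'' : Continuous α'') :
    (α L * ∫ θ in (0:ℝ)..(2*π), Ut (L, θ)) - (α 0 * ∫ θ in (0:ℝ)..(2*π), Ut (0, θ))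
    = - (∫ p in bx 0 L, α p.1 * (K p * exp (U p))) - ∫ p in bx 0 L, α'' p.1 * U p := by
  have := h.green α α' α'' (fun _ => 1) (fun _ => 0) 0 0 L le_rfl h.hL.le le_rfl dα dα' cα''
    (fun t => hasDerivAt_const _ _) (fun t => by simpa using hasDerivAt_const t (0:ℝ)) rfl rfl
  simpa [h.U0, h.UL] using this

lemma wpos {t : ℝ} (hL : 0 < L) (ht : t ∈ Set.Icc 0 L) :
    t * (L - t) ≤ L ^ 2 / 2 * sin (π / L * t) := by
  have hpi := Real.pi_pos
  have h0 := ht.1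
  have h1 : 0 ≤ L - t := sub_nonneg.2 ht.2
  rcases le_total t (L/2) with h | h
  · have e : π / L * t ≤ π / 2 := by
      rw [div_mul_eq_mul_div, div_le_div_iff₀ hL (by norm_num)]; nlinarith
    have := Real.mul_le_sin (x := π / L * t) (by positivity) e
    have e2 : 2 / π * (π / L * t) = 2 * t / L := by field_simp
    rw [e2] at this
    calc t * (L - t) ≤ t * L := by nlinarith
      _ = L ^ 2 / 2 * (2 * t / L) := by field_simp
      _ ≤ _ := by gcongr
  · have e : π / L * (L - t) ≤ π / 2 := by
      rw [div_mul_eq_mul_div, div_le_div_iff₀ hL (by norm_num)]; nlinarith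
    have := Real.mul_le_sin (x := π / L * (L - t)) (by positivity) e
    have e2 : 2 / π * (π / L * (L - t)) = 2 * (L - t) / L := by field_simp
    have e3 : sin (π / L * (L - t)) = sin (π / L * t) := by
      rw [show π / L * (L - t) = π - π / L * t by field_simp, sin_pi_sub]
    rw [e2, e3] at this
    calc t * (L - t) ≤ L * (L - t) := by nlinarith
      _ = L ^ 2 / 2 * (2 * (L - t) / L) := by field_simp
      _ ≤ _ := by gcongr

/-- weighted mass bound -/
lemma wmass (L k0 : ℝ) : ∃ D : ℝ, 0 ≤ D ∧ ∀ (C1 : ℝ) (U Ut Uh K : ℝ × ℝ → ℝ),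
    Cyl L k0 C1 U Ut Uh K → ∫ p in bx 0 L, p.1 * (L - p.1) * (K p * exp (U p)) ≤ D := by
  have hpi := Real.pi_pos
  set lam := (π / L) ^ 2 with hlam
  set c := k0 / (2 * lam) with hc
  set W := volume.real (bx 0 L) with hW
  refine ⟨L ^ 2 / 2 * (2 * (lam * |1 + log c| * W)), by positivity, ?_⟩
  intro C1 U Ut Uh K h
  have hL := h.hL
  have hk := h.hk
  have lpos : 0 < lam := by positivity
  have cpos : 0 < c := by positivity
  have hs : bx 0 L ⊆ strip L := bx_sub le_rfl le_rfl
  have cμ := h.cμ.mono hs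
  have cU := h.cU.mono hs
  have g := h.green0 (fun t => sin (π / L * t)) (fun t => cos (π / L * t) * (π / L))
    (fun t => -sin (π / L * t) * (π / L) * (π / L))
    (fun t => ((hasDerivAt_id t).const_mul (π/L)).sin.congr_deriv (by simp))
    (fun t => (((hasDerivAt_id t).const_mul (π/L)).cos.mul_const (π/L)).congr_deriv (by simp))
    (by fun_prop)
  have e1 : sin (π / L * L) = 0 := by rw [div_mul_cancel₀ _ hL.ne', sin_pi]
  simp only [e1, mul_zero, sin_zero, zero_mul, sub_self] at g
  have cs : ContinuousOn (fun p : ℝ × ℝ => sin (π / L * p.1)) (bx 0 L) := by fun_prop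
  have i1 : IntegrableOn (fun p : ℝ × ℝ => sin (π / L * p.1) * (K p * exp (U p))) (bx 0 L) :=
    bx_int (cs.mul cμ)
  have i2 : IntegrableOn (fun p : ℝ × ℝ => sin (π / L * p.1) * U p) (bx 0 L) := bx_int (cs.mul cU)
  have i4 : IntegrableOn (fun p : ℝ × ℝ => 1/2 * (sin (π / L * p.1) * (K p * exp (U p)))) (bx 0 L) :=
    i1.const_mul _
  have i5 : IntegrableOn (fun p : ℝ × ℝ => lam * |1 + log c|) (bx 0 L) :=
    bx_int continuousOn_const
  have i3 : IntegrableOn (fun p : ℝ × ℝ => 1/2 * (sin (π / L * p.1) * (K p * exp (U p)))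
      + lam * |1 + log c|) (bx 0 L) := i4.add i5
  have snn : ∀ p ∈ bx 0 L, 0 ≤ sin (π / L * p.1) := by
    intro p hp
    have := wpos hL hp.1
    have h2 : 0 ≤ p.1 * (L - p.1) := mul_nonneg hp.1.1 (sub_nonneg.2 hp.1.2)
    have h3 : 0 < L^2/2 := by positivity
    by_contra hc
    push Not at hc
    nlinarith [mul_neg_of_pos_of_neg h3 hc]
  have e2 : ∫ p in bx 0 L, -sin (π / L * p.1) * (π / L) * (π / L) * U p
      = - (lam * ∫ p in bx 0 L, sin (π / L * p.1) * U p) := by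
    rw [← integral_const_mul, ← integral_neg]
    congr 1; funext p; rw [hlam]; ring
  rw [e2] at g
  have e3 : ∫ p in bx 0 L, sin (π / L * p.1) * (K p * exp (U p))
      = lam * ∫ p in bx 0 L, sin (π / L * p.1) * U p := by linarith
  have ptw : lam * ∫ p in bx 0 L, sin (π / L * p.1) * U p ≤
     ∫ p in bx 0 L, (1/2 * (sin (π / L * p.1) * (K p * exp (U p))) + lam * |1 + log c|) := by
    rw [← integral_const_mul]
    apply setIntegral_mono_on (i2.const_mul _)
      i3 (bx_meas 0 L)
    intro p hp
    have s0 := snn p hp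
    have s1 := sin_le_one (π / L * p.1)
    have hkp := h.kK p (hs hp)
    have ex : U p + log c + 1 ≤ c * exp (U p) := by
      have := add_one_le_exp (U p + log c)
      rw [exp_add, exp_log cpos] at this
      linarith
    have ex2 : lam * (c * exp (U p)) ≤ 1/2 * (K p * exp (U p)) := by
      have : lam * c = k0 / 2 := by rw [hc]; field_simp
      rw [← mul_assoc, this]
      nlinarith [exp_pos (U p)]
    have ex3 : lam * U p ≤ 1/2 * (K p * exp (U p)) + lam * |1 + log c| := by
      have := neg_abs_le (1 + log c)
      nlinarith [mul_le_mul_of_nonneg_left ex lpos.le, mul_le_mul_of_nonneg_left this lpos.le]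
    have nn : 0 ≤ lam * |1 + log c| := by positivity
    calc lam * (sin (π / L * p.1) * U p) = sin (π / L * p.1) * (lam * U p) := by ring
      _ ≤ sin (π / L * p.1) * (1/2 * (K p * exp (U p)) + lam * |1 + log c|) := by gcongr
      _ ≤ _ := by nlinarith
  rw [integral_add i4 i5,
    integral_const_mul, setIntegral_const, smul_eq_mul, ← hW, ← e3] at ptw
  have fin : ∫ p in bx 0 L, p.1 * (L - p.1) * (K p * exp (U p)) ≤
      ∫ p in bx 0 L, L ^ 2 / 2 * (sin (π / L * p.1) * (K p * exp (U p))) := by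
    apply setIntegral_mono_on _ (i1.const_mul _) (bx_meas 0 L)
    · intro p hp
      have := wpos hL hp.1
      have := mul_le_mul_of_nonneg_right this (h.μpos p (hs hp)).le
      linarith
    · exact bx_int (ContinuousOn.mul (by fun_prop) cμ)
  rw [integral_const_mul] at fin
  refine fin.trans ?_
  gcongr
  linarith

lemma not_min_aux {f f' : ℝ → ℝ} {x A : ℝ} (hA : A < 0) (hf : ∀ᶠ y in nhds x, HasDerivAt f (f' y) y)
    (hf' : HasDerivAt f' A x) (hm : IsLocalMin f x) : False := by
  have d0 : f' x = 0 := hm.hasDerivAt_eq_zero hf.self_of_nhds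
  have ed : deriv f =ᶠ[nhds x] f' := hf.mono (fun y hy => hy.deriv)
  have dd : deriv (deriv f) x = A := by rw [ed.deriv_eq, hf'.deriv]
  have hM : IsLocalMax f x := isLocalMax_of_deriv_deriv_neg (by rw [dd]; exact hA)
    (by rw [hf.self_of_nhds.deriv, d0]) hf.self_of_nhds.continuousAt
  have hc : f =ᶠ[nhds x] fun _ => f x := by
    filter_upwards [hM, hm] with y h1 h2
    exact le_antisymm h1 h2
  have : deriv f =ᶠ[nhds x] fun _ => 0 := by
    have := hc.deriv
    simpa using this
  have := this.deriv_eq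
  rw [dd] at this
  simp at this
  linarith

lemma Unonneg (h : Cyl L k0 C1 U Ut Uh K) (p : ℝ × ℝ) (hp : p ∈ bx 0 L) : 0 ≤ U p := by
  have hs : bx 0 L ⊆ strip L := bx_sub le_rfl le_rfl
  have hpi := Real.pi_pos
  obtain ⟨m, hm, hmin⟩ := (bx_compact 0 L).exists_isMinOn ⟨p, hp⟩ (h.cU.mono hs)
  suffices 0 ≤ U m from this.trans (hmin hp)
  by_contra hneg
  push Not at hneg
  -- global minimum on the strip
  have glob : ∀ q ∈ strip L, U m ≤ U q := by
    rintro ⟨t, θ⟩ hq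
    have per : Function.Periodic (fun θ => U (t, θ)) (2*π) := fun θ => h.pU t hq.1 θ
    obtain ⟨y, hy, hye⟩ := per.exists_mem_Ico₀ (by positivity) θ
    have h3 : U m ≤ U (t, y) := hmin (show (t, y) ∈ bx 0 L from ⟨hq.1, hy.1, hy.2.le⟩)
    exact h3.trans_eq hye.symm
  have m0 : m.1 ≠ 0 := by
    intro e
    have : U (m.1, m.2) = 0 := by rw [e]; exact h.U0 m.2
    change U m = 0 at this
    linarith
  have mL : m.1 ≠ L := by
    intro e
    have : U (m.1, m.2) = 0 := by rw [e]; exact h.UL m.2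
    change U m = 0 at this
    linarith
  have hm1 : m.1 ∈ Set.Ioo 0 L := ⟨lt_of_le_of_ne hm.1.1 (Ne.symm m0), lt_of_le_of_ne hm.1.2 mL⟩
  obtain ⟨A, B, C, hA, hC, hAC⟩ := h.d2 m hm1
  have hμ := h.μpos m (hs hm)
  rcases lt_or_ge A 0 with hA0 | hA0
  · refine not_min_aux (f := fun t => U (t, m.2)) (f' := fun t => Ut (t, m.2)) (x := m.1) hA0 ?_ ?_ ?_
    · filter_upwards [isOpen_Ioo.mem_nhds hm1] with y hy
      exact dslice1 (h.dU (y, m.2) hy)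
    · exact dslice1 hA
    · filter_upwards [isOpen_Ioo.mem_nhds hm1] with y hy
      exact glob (y, m.2) ⟨⟨hy.1.le, hy.2.le⟩, trivial⟩
  · have hC0 : C < 0 := by linarith
    refine not_min_aux (f := fun t => U (m.1, t)) (f' := fun t => Uh (m.1, t)) (x := m.2) hC0 ?_ ?_ ?_
    · filter_upwards with y
      exact dslice2 (h.dU (m.1, y) hm1)
    · exact dslice2 hC
    · filter_upwards with y
      exact glob (m.1, y) ⟨⟨hm1.1.le, hm1.2.le⟩, trivial⟩

lemma intU (h : Cyl L k0 C1 U Ut Uh K) :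
    2 * ∫ p in bx 0 L, U p = ∫ p in bx 0 L, p.1 * (L - p.1) * (K p * exp (U p)) := by
  have g := h.green0 (fun t => t * (L - t)) (fun t => L - 2 * t) (fun t => -2)
    (fun t => ((hasDerivAt_id t).mul ((hasDerivAt_id t).const_sub L)).congr_deriv (by simp; ring))
    (fun t => (((hasDerivAt_id t).const_mul 2).const_sub L).congr_deriv (by simp))
    continuous_const
  simp only [sub_self, mul_zero, zero_mul] at g
  rw [integral_const_mul] at g
  linarith

lemma flux_out (h : Cyl L k0 C1 U Ut Uh K) :
    L * ∫ θ in (0:ℝ)..(2*π), Ut (L, θ) = - ∫ p in bx 0 L, p.1 * (K p * exp (U p)) := by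
  have g := h.green0 (fun t => t) (fun t => 1) (fun t => 0)
    (fun t => hasDerivAt_id t) (fun t => hasDerivAt_const _ _) continuous_const
  simpa using g

lemma flux_in (h : Cyl L k0 C1 U Ut Uh K) :
    L * ∫ θ in (0:ℝ)..(2*π), Ut (0, θ) = ∫ p in bx 0 L, (L - p.1) * (K p * exp (U p)) := by
  have g := h.green0 (fun t => L - t) (fun t => -1) (fun t => 0)
    (fun t => ((hasDerivAt_id t).const_sub L)) (fun t => hasDerivAt_const _ _) continuous_const
  simpa using g

end Cyl

namespace Cyl
variable {L k0 C1 : ℝ} {U Ut Uh K : ℝ × ℝ → ℝ}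

lemma dalpha (κ ℓ t0 : ℝ) (t : ℝ) :
    HasDerivAt (fun s : ℝ => (1 - ((s - t0) / ℓ) ^ 4) * exp (-κ * (s - t0)))
      ((-(4 * ((t - t0) / ℓ) ^ 3 * (1 / ℓ)) - κ * (1 - ((t - t0) / ℓ) ^ 4)) * exp (-κ * (t - t0))) t := by
  have h1 : HasDerivAt (fun s : ℝ => (s - t0) / ℓ) (1 / ℓ) t := ((hasDerivAt_id t).sub_const t0).div_const ℓ
  have h2 : HasDerivAt (fun s : ℝ => exp (-κ * (s - t0))) (exp (-κ * (t - t0)) * (-κ)) t :=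
    (((hasDerivAt_id t).sub_const t0).const_mul (-κ)).exp.congr_deriv (by simp)
  exact (((h1.pow 4).const_sub 1).mul h2).congr_deriv (by push_cast; simp; ring)

lemma dalpha' (κ ℓ t0 : ℝ) (t : ℝ) :
    HasDerivAt (fun t : ℝ => (-(4 * ((t - t0) / ℓ) ^ 3 * (1 / ℓ)) - κ * (1 - ((t - t0) / ℓ) ^ 4)) * exp (-κ * (t - t0)))
      (κ ^ 2 * ((1 - ((t - t0) / ℓ) ^ 4) * exp (-κ * (t - t0)))
        + (-12 * ((t - t0) / ℓ) ^ 2 / ℓ ^ 2 + 8 * κ * ((t - t0) / ℓ) ^ 3 / ℓ) * exp (-κ * (t - t0))) t := by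
  have h1 : HasDerivAt (fun s : ℝ => (s - t0) / ℓ) (1 / ℓ) t := ((hasDerivAt_id t).sub_const t0).div_const ℓ
  have h2 : HasDerivAt (fun s : ℝ => exp (-κ * (s - t0))) (exp (-κ * (t - t0)) * (-κ)) t :=
    (((hasDerivAt_id t).sub_const t0).const_mul (-κ)).exp.congr_deriv (by simp)
  exact ((((((h1.pow 3).const_mul 4).mul_const (1 / ℓ)).neg).sub
    (((h1.pow 4).const_sub 1).const_mul κ)).mul h2).congr_deriv (by push_cast; simp; ring)

/-- one sided representation, generic -/
lemma side (h : Cyl L k0 C1 U Ut Uh K) (κ ℓ t0 t₁ t₂ : ℝ) (γ γ' : ℝ → ℝ)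
    (h1 : 0 ≤ t₁) (h12 : t₁ ≤ t₂) (h2 : t₂ ≤ L)
    (dγ : ∀ t, HasDerivAt γ (γ' t) t) (dγ' : ∀ t, HasDerivAt γ' (-κ^2 * γ t) t)
    (pγ : γ (2*π) = γ 0) (pγ' : γ' (2*π) = γ' 0) :
    (∫ θ in (0:ℝ)..(2*π), ((1 - ((t₂ - t0) / ℓ) ^ 4) * exp (-κ * (t₂ - t0)) * Ut (t₂, θ) -
      (-(4 * ((t₂ - t0) / ℓ) ^ 3 * (1 / ℓ)) - κ * (1 - ((t₂ - t0) / ℓ) ^ 4)) * exp (-κ * (t₂ - t0)) * U (t₂, θ)) * γ θ)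
      - (∫ θ in (0:ℝ)..(2*π), ((1 - ((t₁ - t0) / ℓ) ^ 4) * exp (-κ * (t₁ - t0)) * Ut (t₁, θ) -
      (-(4 * ((t₁ - t0) / ℓ) ^ 3 * (1 / ℓ)) - κ * (1 - ((t₁ - t0) / ℓ) ^ 4)) * exp (-κ * (t₁ - t0)) * U (t₁, θ)) * γ θ)
    = - (∫ p in bx t₁ t₂, (1 - ((p.1 - t0) / ℓ) ^ 4) * (K p * exp (U p)) * (exp (-κ * (p.1 - t0)) * γ p.2))
      - ∫ p in bx t₁ t₂, (-12 * ((p.1 - t0) / ℓ) ^ 2 / ℓ ^ 2 + 8 * κ * ((p.1 - t0) / ℓ) ^ 3 / ℓ) * exp (-κ * (p.1 - t0)) * γ p.2 * U p := by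
  have g := h.green _ _ _ γ γ' (κ^2) t₁ t₂ h1 h12 h2 (dalpha κ ℓ t0) (dalpha' κ ℓ t0)
    (by fun_prop) dγ dγ' pγ pγ'
  rw [g]
  congr 1
  · congr 2; funext p; ring
  · congr 1; funext p; ring

lemma right (h : Cyl L k0 C1 U Ut Uh K) (κ t0 : ℝ) (γ γ' : ℝ → ℝ)
    (h1 : 0 ≤ t0) (h2 : t0 < L)
    (dγ : ∀ t, HasDerivAt γ (γ' t) t) (dγ' : ∀ t, HasDerivAt γ' (-κ^2 * γ t) t)
    (pγ : γ (2*π) = γ 0) (pγ' : γ' (2*π) = γ' 0) :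
    (∫ θ in (0:ℝ)..(2*π), (Ut (t0, θ) + κ * U (t0, θ)) * γ θ) =
     (∫ p in bx t0 L, (1 - ((p.1 - t0) / (L - t0)) ^ 4) * (K p * exp (U p)) * (exp (-κ * (p.1 - t0)) * γ p.2))
      + ∫ p in bx t0 L, (-12 * ((p.1 - t0) / (L - t0)) ^ 2 / (L - t0) ^ 2 + 8 * κ * ((p.1 - t0) / (L - t0)) ^ 3 / (L - t0)) * exp (-κ * (p.1 - t0)) * γ p.2 * U p := by
  have g := h.side κ (L - t0) t0 t0 L γ γ' h1 h2.le le_rfl dγ dγ' pγ pγ'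
  have hne : L - t0 ≠ 0 := by linarith
  simp only [h.UL, div_self hne, sub_self, zero_div, mul_zero, one_pow, exp_zero, zero_mul,
    intervalIntegral.integral_zero, ne_eq, OfNat.ofNat_ne_zero, not_false_eq_true, zero_pow, sub_zero,
    mul_one, one_mul, neg_zero, zero_sub, neg_mul, sub_neg_eq_add] at g
  simp only [neg_mul]
  linarith

lemma left (h : Cyl L k0 C1 U Ut Uh K) (κ t0 : ℝ) (γ γ' : ℝ → ℝ)
    (h1 : 0 < t0) (h2 : t0 ≤ L)
    (dγ : ∀ t, HasDerivAt γ (γ' t) t) (dγ' : ∀ t, HasDerivAt γ' (-κ^2 * γ t) t)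
    (pγ : γ (2*π) = γ 0) (pγ' : γ' (2*π) = γ' 0) :
    (∫ θ in (0:ℝ)..(2*π), (κ * U (t0, θ) - Ut (t0, θ)) * γ θ) =
     (∫ p in bx 0 t0, (1 - ((t0 - p.1) / t0) ^ 4) * (K p * exp (U p)) * (exp (-κ * (t0 - p.1)) * γ p.2))
      + ∫ p in bx 0 t0, (-12 * ((t0 - p.1) / t0) ^ 2 / t0 ^ 2 + 8 * κ * ((t0 - p.1) / t0) ^ 3 / t0) * exp (-κ * (t0 - p.1)) * γ p.2 * U p := by
  have g := h.side (-κ) t0 t0 0 t0 γ γ' le_rfl h1.le h2 dγ (by simpa using dγ') pγ pγ'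
  have hne : t0 ≠ 0 := by linarith
  have e0 : ((-1:ℝ))^4 = 1 := by norm_num
  simp only [h.U0, zero_sub, neg_div, div_self hne, e0, sub_self, zero_div, mul_zero, one_pow, exp_zero, zero_mul,
    intervalIntegral.integral_zero, ne_eq, OfNat.ofNat_ne_zero, not_false_eq_true, zero_pow, sub_zero,
    mul_one, one_mul, neg_zero] at g
  have e1 : ∫ θ in (0:ℝ)..(2*π), (κ * U (t0, θ) - Ut (t0, θ)) * γ θ =
     - ∫ θ in (0:ℝ)..(2*π), (Ut (t0, θ) - - -κ * U (t0, θ)) * γ θ := by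
    rw [← intervalIntegral.integral_neg]; congr 1; funext θ; ring
  rw [e1, g]
  have e2 : ∀ p : ℝ × ℝ, (p.1 - t0) / t0 = - ((t0 - p.1) / t0) := fun p => by ring
  have e3 : ∀ p : ℝ × ℝ, p.1 - t0 = - (t0 - p.1) := fun p => by ring
  rw [neg_sub, sub_neg_eq_add, add_comm]
  congr 1
  · congr 1; funext p; rw [e2]; rw [show - -κ * (p.1 - t0) = -κ * (t0 - p.1) by ring]; ring
  · congr 1; funext p; rw [e2]; rw [show - -κ * (p.1 - t0) = -κ * (t0 - p.1) by ring]; ring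

lemma one_sub_pow4 {x : ℝ} (h0 : 0 ≤ x) (h1 : x ≤ 1) : 0 ≤ 1 - x^4 ∧ 1 - x^4 ≤ 4 * (1 - x) := by
  have a2 : x^2 ≤ 1 := by nlinarith
  have a3 : x^3 ≤ 1 := by nlinarith [sq_nonneg x]
  have e : 1 - x^4 = (1-x) * (1 + x + x^2 + x^3) := by ring
  rw [e]
  constructor
  · have := sub_nonneg.2 h1; positivity
  · nlinarith

lemma rker {k x ℓ : ℝ} (hk : 1 ≤ k) (hℓ : 0 < ℓ) (hx : 0 ≤ x) :
    |(-12 * (x / ℓ) ^ 2 / ℓ ^ 2 + 8 * k * (x / ℓ) ^ 3 / ℓ) * exp (-k * x)| ≤ 72 / ℓ^4 / k^2 := by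
  have hk0 : 0 < k := by linarith
  set y := k * x with hy
  have y0 : 0 ≤ y := by positivity
  have e2 := Real.pow_div_factorial_le_exp y y0 2
  have e3 := Real.pow_div_factorial_le_exp y y0 3
  simp [Nat.factorial] at e2 e3
  have ex : x = y / k := by rw [hy]; field_simp
  have e4 : (-12 * (x / ℓ) ^ 2 / ℓ ^ 2 + 8 * k * (x / ℓ) ^ 3 / ℓ) * exp (-k * x)
     = 1 / ℓ^4 / k^2 * ((-12 * y^2 + 8 * y^3) / exp y) := by
    rw [show -k * x = - y by rw [hy]; ring, exp_neg, ex]; field_simp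
  rw [e4, abs_mul, abs_of_pos (by positivity), show 72 / ℓ^4/k^2 = 1/ℓ^4/k^2 * 72 by ring]
  gcongr
  rw [abs_div, abs_of_pos (exp_pos y), div_le_iff₀ (exp_pos y)]
  rw [abs_le]
  have : 0 ≤ y^2 := by positivity
  have : 0 ≤ y^3 := by positivity
  constructor <;> linarith

lemma abs_int_le {s S : Set (ℝ × ℝ)} {F G : ℝ × ℝ → ℝ} (hs : s ⊆ S) (ms : MeasurableSet s)
    (mS : MeasurableSet S) (iG : IntegrableOn G S) (iF : IntegrableOn F s)
    (hG : ∀ p ∈ S, 0 ≤ G p)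
    (hF : ∀ p ∈ s, |F p| ≤ G p) : |∫ p in s, F p| ≤ ∫ p in S, G p := by
  calc |∫ p in s, F p| ≤ ∫ p in s, |F p| := abs_integral_le_integral_abs
    _ ≤ ∫ p in s, G p := setIntegral_mono_on iF.abs (iG.mono_set hs) ms hF
    _ ≤ _ := setIntegral_mono_set iG (by
      filter_upwards [ae_restrict_mem mS] with p hp using hG p hp) (Filter.Eventually.of_forall hs)

end Cyl

namespace Cyl
variable {L k0 C1 : ℝ} {U Ut Uh K : ℝ × ℝ → ℝ}

lemma w_right {t0 s : ℝ} (hL : 0 < L) (ht : t0 ∈ Set.Icc (L/3) (2*L/3)) (hs : s ∈ Set.Icc t0 L) :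
    0 ≤ 1 - ((s - t0) / (L - t0)) ^ 4 ∧
    1 - ((s - t0) / (L - t0)) ^ 4 ≤ 36 / L^2 * (s * (L - s)) := by
  have h1 := ht.1
  have h2 := ht.2
  have h3 := hs.1
  have h4 := hs.2
  have hp : 0 < L - t0 := by linarith
  obtain ⟨q1, q2⟩ := one_sub_pow4 (x := (s - t0) / (L - t0)) (div_nonneg (by linarith) hp.le)
    (by rw [div_le_one hp]; linarith)
  refine ⟨q1, q2.trans ?_⟩
  have e : 4 * (1 - (s - t0) / (L - t0)) = 4 * ((L - s) / (L - t0)) := by field_simp; ring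
  rw [e]
  calc 4 * ((L - s) / (L - t0)) ≤ 4 * ((L - s) / (L / 3)) := by
        gcongr <;> linarith
    _ = 36 / L^2 * (L / 3 * (L - s)) := by field_simp; norm_num; try ring
    _ ≤ 36 / L^2 * (s * (L - s)) := by
        gcongr <;> linarith

lemma w_left {t0 s : ℝ} (hL : 0 < L) (ht : t0 ∈ Set.Icc (L/3) (2*L/3)) (hs : s ∈ Set.Icc 0 t0) :
    0 ≤ 1 - ((t0 - s) / t0) ^ 4 ∧
    1 - ((t0 - s) / t0) ^ 4 ≤ 36 / L^2 * (s * (L - s)) := by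
  have := w_right (L := L) (t0 := L - t0) (s := L - s) hL ⟨by linarith [ht.2], by linarith [ht.1]⟩
    ⟨by linarith [hs.2], by linarith [hs.1]⟩
  rw [show L - s - (L - t0) = t0 - s by ring, show L - (L - t0) = t0 by ring] at this
  refine ⟨this.1, this.2.trans_eq (by ring)⟩

lemma nb_right (h : Cyl L k0 C1 U Ut Uh K) {D t0 : ℝ}
    (hD : ∫ p in bx 0 L, p.1 * (L - p.1) * (K p * exp (U p)) ≤ D)
    (ht : t0 ∈ Set.Icc (L/3) (2*L/3)) (g : ℝ × ℝ → ℝ) (cg : Continuous g)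
    (hg : ∀ p ∈ bx t0 L, |g p| ≤ 1) :
    |∫ p in bx t0 L, (1 - ((p.1 - t0) / (L - t0)) ^ 4) * (K p * exp (U p)) * g p| ≤ 36 / L^2 * D := by
  have hL := h.hL
  have hs : bx 0 L ⊆ strip L := bx_sub le_rfl le_rfl
  have hs2 : bx t0 L ⊆ bx 0 L := bx_mono (by linarith [ht.1]) le_rfl
  have cμ := h.cμ.mono hs
  have iG : IntegrableOn (fun p : ℝ × ℝ => 36 / L^2 * (p.1 * (L - p.1) * (K p * exp (U p)))) (bx 0 L) :=
    bx_int (continuousOn_const.mul (ContinuousOn.mul (by fun_prop) cμ))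
  refine (abs_int_le hs2 (bx_meas _ _) (bx_meas _ _) iG ?_ ?_ ?_).trans ?_
  · exact bx_int ((ContinuousOn.mul (by fun_prop) (cμ.mono hs2)).mul cg.continuousOn)
  · intro p hp
    have := (h.μpos p (hs hp)).le
    have := hp.1.1
    have := sub_nonneg.2 hp.1.2
    positivity
  · intro p hp
    have m0 := (h.μpos p (hs (hs2 hp))).le
    obtain ⟨q1, q2⟩ := w_right hL ht hp.1
    rw [abs_mul, abs_of_nonneg (mul_nonneg q1 m0)]
    calc _ ≤ (1 - ((p.1 - t0) / (L - t0)) ^ 4) * (K p * exp (U p)) * 1 := by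
          gcongr; exact hg p hp
      _ ≤ 36 / L^2 * (p.1 * (L - p.1)) * (K p * exp (U p)) := by rw [mul_one]; gcongr
      _ = _ := by ring
  · rw [integral_const_mul]; gcongr

lemma nb_left (h : Cyl L k0 C1 U Ut Uh K) {D t0 : ℝ}
    (hD : ∫ p in bx 0 L, p.1 * (L - p.1) * (K p * exp (U p)) ≤ D)
    (ht : t0 ∈ Set.Icc (L/3) (2*L/3)) (g : ℝ × ℝ → ℝ) (cg : Continuous g)
    (hg : ∀ p ∈ bx 0 t0, |g p| ≤ 1) :
    |∫ p in bx 0 t0, (1 - ((t0 - p.1) / t0) ^ 4) * (K p * exp (U p)) * g p| ≤ 36 / L^2 * D := by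
  have hL := h.hL
  have hs : bx 0 L ⊆ strip L := bx_sub le_rfl le_rfl
  have hs2 : bx 0 t0 ⊆ bx 0 L := bx_mono le_rfl (by linarith [ht.2])
  have cμ := h.cμ.mono hs
  have iG : IntegrableOn (fun p : ℝ × ℝ => 36 / L^2 * (p.1 * (L - p.1) * (K p * exp (U p)))) (bx 0 L) :=
    bx_int (continuousOn_const.mul (ContinuousOn.mul (by fun_prop) cμ))
  refine (abs_int_le hs2 (bx_meas _ _) (bx_meas _ _) iG ?_ ?_ ?_).trans ?_
  · exact bx_int ((ContinuousOn.mul (by fun_prop) (cμ.mono hs2)).mul cg.continuousOn)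
  · intro p hp
    have := (h.μpos p (hs hp)).le
    have := hp.1.1
    have := sub_nonneg.2 hp.1.2
    positivity
  · intro p hp
    have m0 := (h.μpos p (hs (hs2 hp))).le
    obtain ⟨q1, q2⟩ := w_left hL ht hp.1
    rw [abs_mul, abs_of_nonneg (mul_nonneg q1 m0)]
    calc _ ≤ (1 - ((t0 - p.1) / t0) ^ 4) * (K p * exp (U p)) * 1 := by
          gcongr; exact hg p hp
      _ ≤ 36 / L^2 * (p.1 * (L - p.1)) * (K p * exp (U p)) := by rw [mul_one]; gcongr
      _ = _ := by ring
  · rw [integral_const_mul]; gcongr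

lemma ell_bd {ℓ k : ℝ} (hL : 0 < L) (hℓ : L / 3 ≤ ℓ) (hk : 1 ≤ k) :
    72 / ℓ^4 / k^2 ≤ 72 * 81 / L^4 / k^2 := by
  have : 72 * 81 / L^4 = 72 / (L/3)^4 := by field_simp; norm_num; try ring
  rw [this]; gcongr

lemma rb_gen (h : Cyl L k0 C1 U Ut Uh K) {D t₁ t₂ k : ℝ} (ρ g : ℝ × ℝ → ℝ)
    (hD : ∫ p in bx 0 L, p.1 * (L - p.1) * (K p * exp (U p)) ≤ D) (h1 : 0 ≤ t₁) (h2 : t₂ ≤ L)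
    (cρ : Continuous ρ) (cg : Continuous g) (hρ : ∀ p ∈ bx t₁ t₂, |ρ p| ≤ 72 * 81 / L^4 / k^2)
    (hg : ∀ p, |g p| ≤ 1) :
    |∫ p in bx t₁ t₂, ρ p * g p * U p| ≤ 72 * 81 / L^4 * D / k^2 := by
  have hL := h.hL
  have hs : bx 0 L ⊆ strip L := bx_sub le_rfl le_rfl
  have hs2 : bx t₁ t₂ ⊆ bx 0 L := bx_mono h1 h2
  have cU := h.cU.mono hs
  have iG : IntegrableOn (fun p : ℝ × ℝ => 72 * 81 / L^4 / k^2 * U p) (bx 0 L) :=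
    bx_int (continuousOn_const.mul cU)
  have D0 : 0 ≤ ∫ p in bx 0 L, U p := setIntegral_nonneg (bx_meas _ _) (fun p hp => h.Unonneg p hp)
  have hI := h.intU
  refine (abs_int_le hs2 (bx_meas _ _) (bx_meas _ _) iG ?_ ?_ ?_).trans ?_
  · exact bx_int (ContinuousOn.mul (by fun_prop) (cU.mono hs2))
  · intro p hp
    have := h.Unonneg p hp
    positivity
  · intro p hp
    have u0 := h.Unonneg p (hs2 hp)
    rw [abs_mul, abs_mul, abs_of_nonneg u0]
    calc |ρ p| * |g p| * U p ≤ 72 * 81 / L^4 / k^2 * 1 * U p := by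
          gcongr
          · exact hρ p hp
          · exact hg p
      _ = _ := by ring
  · rw [integral_const_mul, show 72 * 81 / L^4 * D / k^2 = 72 * 81 / L^4 / k^2 * D by ring]
    gcongr
    linarith

lemma coef_alg {A B N1 N2 R1 R2 N R k : ℝ} (hk : 1 ≤ k) (er : A + B = N1 + R1) (el : B - A = N2 + R2)
    (br : |N1| ≤ N) (bl : |N2| ≤ N) (rr : |R1| ≤ R / k^2) (rl : |R2| ≤ R / k^2) :
    A^2 - B^2 ≤ -(N1 * N2) + (2 * N * R + R^2) / k^2 := by
  have e : A^2 - B^2 = -((A+B)*(B-A)) := by ring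
  rw [e, er, el]
  have hk2 : 1 ≤ k^2 := by nlinarith
  have N0 := (abs_nonneg _).trans br
  have R0 := (abs_nonneg _).trans rr
  have q1 : |N1 * R2| ≤ N * (R/k^2) := by rw [abs_mul]; gcongr
  have q2 : |R1 * N2| ≤ (R/k^2) * N := by rw [abs_mul]; gcongr
  have q3 : |R1 * R2| ≤ (R/k^2) * (R/k^2) := by rw [abs_mul]; gcongr
  have q4 : (R/k^2) * (R/k^2) ≤ R^2 / k^2 := by
    rw [div_mul_div_comm, ← sq]
    gcongr
    nlinarith
  have e5 : (2 * N * R + R^2) / k^2 = N * (R/k^2) + (R/k^2) * N + R^2/k^2 := by ring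
  rw [e5]
  have := neg_abs_le (N1 * R2)
  have := neg_abs_le (R1 * N2)
  have := neg_abs_le (R1 * R2)
  nlinarith

/-- paired coefficient bound for one frequency and one phase -/
lemma coef (h : Cyl L k0 C1 U Ut Uh K) {D t0 : ℝ}
    (hD : ∫ p in bx 0 L, p.1 * (L - p.1) * (K p * exp (U p)) ≤ D)
    (ht : t0 ∈ Set.Icc (L/3) (2*L/3)) (k : ℝ) (hk : 1 ≤ k) (γ γ' : ℝ → ℝ)
    (dγ : ∀ t, HasDerivAt γ (γ' t) t) (dγ' : ∀ t, HasDerivAt γ' (-k^2 * γ t) t)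
    (pγ : γ (2*π) = γ 0) (pγ' : γ' (2*π) = γ' 0) (bγ : ∀ t, |γ t| ≤ 1) :
    (∫ θ in (0:ℝ)..(2*π), Ut (t0, θ) * γ θ)^2 - (k * ∫ θ in (0:ℝ)..(2*π), U (t0, θ) * γ θ)^2
    ≤ -((∫ p in bx t0 L, (1 - ((p.1 - t0) / (L - t0)) ^ 4) * (K p * exp (U p)) * (exp (-k * (p.1 - t0)) * γ p.2))
      * (∫ p in bx 0 t0, (1 - ((t0 - p.1) / t0) ^ 4) * (K p * exp (U p)) * (exp (-k * (t0 - p.1)) * γ p.2)))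
     + (2 * (36 / L^2 * D) * (72 * 81 / L^4 * D) + (72 * 81 / L^4 * D)^2) / k^2 := by
  have hL := h.hL
  have h1 := ht.1
  have h2 := ht.2
  have t00 : 0 < t0 := by linarith
  have t0L : t0 < L := by linarith
  have cγ : Continuous γ := continuous_iff_continuousAt.2 fun t => (dγ t).continuousAt
  have er := h.right k t0 γ γ' t00.le t0L dγ dγ' pγ pγ'
  have el := h.left k t0 γ γ' t00 t0L.le dγ dγ' pγ pγ'
  have br := h.nb_right hD ht (fun p => exp (-k * (p.1 - t0)) * γ p.2) (by fun_prop) (by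
    intro p hp
    rw [abs_mul, abs_of_pos (exp_pos _)]
    have : exp (-k * (p.1 - t0)) ≤ 1 := by
      rw [exp_le_one_iff]; nlinarith [hp.1.1]
    exact mul_le_one₀ this (abs_nonneg _) (bγ _))
  have bl := h.nb_left hD ht (fun p => exp (-k * (t0 - p.1)) * γ p.2) (by fun_prop) (by
    intro p hp
    rw [abs_mul, abs_of_pos (exp_pos _)]
    have : exp (-k * (t0 - p.1)) ≤ 1 := by
      rw [exp_le_one_iff]; nlinarith [hp.1.2]
    exact mul_le_one₀ this (abs_nonneg _) (bγ _))
  have rr := h.rb_gen (k := k) (t₁ := t0) (t₂ := L) (fun p => (-12 * ((p.1 - t0) / (L - t0)) ^ 2 / (L - t0) ^ 2 + 8 * k * ((p.1 - t0) / (L - t0)) ^ 3 / (L - t0)) * exp (-k * (p.1 - t0)))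
    (fun p => γ p.2) hD t00.le le_rfl (by fun_prop) (by fun_prop) (by
      intro p hp
      exact (rker hk (by linarith) (by linarith [hp.1.1])).trans (ell_bd hL (by linarith) hk))
    (fun p => bγ _)
  have rl := h.rb_gen (k := k) (t₁ := 0) (t₂ := t0) (fun p => (-12 * ((t0 - p.1) / t0) ^ 2 / t0 ^ 2 + 8 * k * ((t0 - p.1) / t0) ^ 3 / t0) * exp (-k * (t0 - p.1)))
    (fun p => γ p.2) hD le_rfl t0L.le (by fun_prop) (by fun_prop) (by
      intro p hp
      exact (rker hk (by linarith) (by linarith [hp.1.2])).trans (ell_bd hL (by linarith) hk))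
    (fun p => bγ _)
  have iU : IntervalIntegrable (fun θ => U (t0, θ) * γ θ) volume 0 (2*π) :=
    ((h.slice h.cU t0 ⟨t00.le, t0L.le⟩).mul cγ).intervalIntegrable _ _
  have it : IntervalIntegrable (fun θ => Ut (t0, θ) * γ θ) volume 0 (2*π) :=
    ((h.slice h.ct t0 ⟨t00.le, t0L.le⟩).mul cγ).intervalIntegrable _ _
  have e1 : ∫ θ in (0:ℝ)..(2*π), (Ut (t0, θ) + k * U (t0, θ)) * γ θ
      = (∫ θ in (0:ℝ)..(2*π), Ut (t0, θ) * γ θ) + k * ∫ θ in (0:ℝ)..(2*π), U (t0, θ) * γ θ := by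
    rw [← intervalIntegral.integral_const_mul, ← intervalIntegral.integral_add it (iU.const_mul k)]
    congr 1; funext θ; ring
  have e2 : ∫ θ in (0:ℝ)..(2*π), (k * U (t0, θ) - Ut (t0, θ)) * γ θ
      = (k * ∫ θ in (0:ℝ)..(2*π), U (t0, θ) * γ θ) - (∫ θ in (0:ℝ)..(2*π), Ut (t0, θ) * γ θ) := by
    rw [← intervalIntegral.integral_const_mul, ← intervalIntegral.integral_sub (iU.const_mul k) it]
    congr 1; funext θ; ring
  rw [e1] at er
  rw [e2] at el
  exact coef_alg hk er el br bl rr rl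

end Cyl

namespace Cyl
variable {L k0 C1 : ℝ} {U Ut Uh K : ℝ × ℝ → ℝ}

lemma mean_bd (h : Cyl L k0 C1 U Ut Uh K) {D t0 : ℝ}
    (hD : ∫ p in bx 0 L, p.1 * (L - p.1) * (K p * exp (U p)) ≤ D)
    (ht : t0 ∈ Set.Icc (L/3) (2*L/3)) :
    (∫ θ in (0:ℝ)..(2*π), Ut (t0, θ))^2 ≤ (36 / L^2 * D)^2 := by
  have hL := h.hL
  have h1 := ht.1
  have h2 := ht.2
  have t00 : 0 < t0 := by linarith
  have t0L : t0 < L := by linarith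
  have er := h.right 0 t0 (fun _ => 1) (fun _ => 0) t00.le t0L
    (fun t => hasDerivAt_const _ _) (fun t => by simpa using hasDerivAt_const t (0:ℝ)) rfl rfl
  have el := h.left 0 t0 (fun _ => 1) (fun _ => 0) t00 t0L.le
    (fun t => hasDerivAt_const _ _) (fun t => by simpa using hasDerivAt_const t (0:ℝ)) rfl rfl
  have br := h.nb_right hD ht (fun p => 1) (by fun_prop) (by simp)
  have bl := h.nb_left hD ht (fun p => 1) (by fun_prop) (by simp)
  have rr : ∫ p in bx t0 L, (-12 * ((p.1 - t0) / (L - t0)) ^ 2 / (L - t0) ^ 2) * U p ≤ 0 := by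
    apply setIntegral_nonpos (bx_meas _ _)
    intro p hp
    have u0 := h.Unonneg p (bx_mono t00.le le_rfl hp)
    have : 0 ≤ ((p.1 - t0) / (L - t0)) ^ 2 / (L - t0) ^ 2 := by positivity
    rw [mul_div_assoc]
    nlinarith [mul_nonneg this u0]
  have rl : ∫ p in bx 0 t0, (-12 * ((t0 - p.1) / t0) ^ 2 / t0 ^ 2) * U p ≤ 0 := by
    apply setIntegral_nonpos (bx_meas _ _)
    intro p hp
    have u0 := h.Unonneg p (bx_mono le_rfl t0L.le hp)
    have : 0 ≤ ((t0 - p.1) / t0) ^ 2 / t0 ^ 2 := by positivity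
    rw [mul_div_assoc]
    nlinarith [mul_nonneg this u0]
  simp only [zero_mul, add_zero, mul_one, neg_zero, exp_zero, mul_zero, zero_div, zero_sub,
    intervalIntegral.integral_neg] at er el br bl
  have q1 := (abs_le.1 br).2
  have q2 := (abs_le.1 bl).2
  apply sq_le_sq'
  · linarith
  · linarith

lemma uh_coef (h : Cyl L k0 C1 U Ut Uh K) {t0 : ℝ} (ht : t0 ∈ Set.Ioo 0 L) (γ γ' : ℝ → ℝ)
    (dγ : ∀ t, HasDerivAt γ (γ' t) t) (cγ' : Continuous γ') (pγ : γ (2*π) = γ 0) :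
    ∫ θ in (0:ℝ)..(2*π), Uh (t0, θ) * γ θ = - ∫ θ in (0:ℝ)..(2*π), U (t0, θ) * γ' θ := by
  have ht' : t0 ∈ Set.Icc 0 L := ⟨ht.1.le, ht.2.le⟩
  have cγ : Continuous γ := continuous_iff_continuousAt.2 fun t => (dγ t).continuousAt
  have i1 : IntervalIntegrable (fun θ => Uh (t0, θ) * γ θ) volume 0 (2*π) :=
    ((h.slice h.ch t0 ht').mul cγ).intervalIntegrable _ _
  have i2 : IntervalIntegrable (fun θ => U (t0, θ) * γ' θ) volume 0 (2*π) :=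
    ((h.slice h.cU t0 ht').mul cγ').intervalIntegrable _ _
  have := intervalIntegral.integral_eq_sub_of_hasDerivAt
    (f := fun θ => U (t0, θ) * γ θ) (f' := fun θ => Uh (t0, θ) * γ θ + U (t0, θ) * γ' θ)
    (a := 0) (b := 2*π) (fun θ _ => (dslice2 (h.dU (t0, θ) ht)).mul (dγ θ)) (i1.add i2)
  rw [intervalIntegral.integral_add i1 i2] at this
  have q := h.pU t0 ht' 0
  rw [zero_add] at q
  rw [q, pγ, sub_self] at this
  linarith

lemma sum_sq (n : ℕ) : ∑ j ∈ Finset.range n, 1 / (((j+1:ℕ):ℝ))^2 ≤ 2 := by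
  have key : ∀ n : ℕ, ∑ j ∈ Finset.range (n+1), 1 / (((j+1:ℕ):ℝ))^2 ≤ 2 - 1 / ((n:ℝ) + 1) := by
    intro n
    induction n with
    | zero => norm_num
    | succ n ih =>
      rw [Finset.sum_range_succ]
      have : 1 / (((n + 1 + 1:ℕ)):ℝ)^2 ≤ 1 / ((n:ℝ)+1) - 1 / (((n+1:ℕ):ℝ)+1) := by
        push_cast
        have : 1 / ((n:ℝ)+1) - 1 / ((n:ℝ)+1+1) = 1 / (((n:ℝ)+1) * ((n:ℝ)+1+1)) := by
          field_simp; ring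
        rw [this]
        apply one_div_le_one_div_of_le (by positivity)
        nlinarith
      linarith
  rcases n with _ | n
  · simp
  · have h1 : (0:ℝ) ≤ 1 / ((n:ℝ) + 1) := by positivity
    linarith [key n]

lemma pbound (L k0 : ℝ) : ∃ Q : ℝ, ∀ (C1 : ℝ) (U Ut Uh K : ℝ × ℝ → ℝ),
    Cyl L k0 C1 U Ut Uh K → ∀ t0 ∈ Set.Icc (L/3) (2*L/3),
    (∫ θ in (0:ℝ)..(2*π), Ut (t0, θ)^2) - (∫ θ in (0:ℝ)..(2*π), Uh (t0, θ)^2) ≤ Q := by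
  have hpi := Real.pi_pos
  obtain ⟨D, D0, hD⟩ := wmass L k0
  set N := 36 / L^2 * D with hN
  set R := 72 * 81 / L^4 * D with hR
  have N0 : 0 ≤ N := by positivity
  have R0 : 0 ≤ R := by positivity
  set E := 2 * (2 * N * R + R^2) with hE
  have E0 : 0 ≤ E := by positivity
  refine ⟨(N^2 + E * 2) / π, ?_⟩
  intro C1 U Ut Uh K h t0 ht
  have hL := h.hL
  have h1 := ht.1
  have h2 := ht.2
  have t00 : 0 < t0 := by linarith
  have t0L : t0 < L := by linarith
  have ht' : t0 ∈ Set.Icc 0 L := ⟨t00.le, t0L.le⟩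
  have hD := hD C1 U Ut Uh K h
  have s1 := parseval_real _ (h.slice h.ct t0 ht')
  have s2 := parseval_real _ (h.slice h.ch t0 ht')
  have sS := s1.sub s2
  have mb := h.mean_bd hD ht
  have sr : bx t0 L ⊆ strip L := bx_sub t00.le le_rfl
  have sl : bx 0 t0 ⊆ strip L := bx_sub le_rfl t0L.le
  have cr := h.cμ.mono sr
  have cl := h.cμ.mono sl
  have key := abel_bound _ _ (N^2/2 + E * 2) (N^2) sS (by
    intro ρ hρ0 hρ1 n
    have car : ContinuousOn (fun p : ℝ × ℝ => (1 - ((p.1 - t0) / (L - t0)) ^ 4) * (K p * exp (U p))) (bx t0 L) :=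
      ContinuousOn.mul (by fun_prop) cr
    have cal : ContinuousOn (fun p : ℝ × ℝ => (1 - ((t0 - p.1) / t0) ^ 4) * (K p * exp (U p))) (bx 0 t0) :=
      ContinuousOn.mul (by fun_prop) cl
    have pp := pos_pair (volume.restrict (bx t0 L)) (volume.restrict (bx 0 t0))
      (fun p : ℝ × ℝ => (1 - ((p.1 - t0) / (L - t0)) ^ 4) * (K p * exp (U p)))
      (fun p => exp (-(p.1 - t0))) (fun p => p.2)
      (fun p : ℝ × ℝ => (1 - ((t0 - p.1) / t0) ^ 4) * (K p * exp (U p)))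
      (fun p => exp (-(t0 - p.1))) (fun p => p.2)
      (by
        filter_upwards [ae_restrict_mem (bx_meas t0 L)] with p hp
        exact ⟨mul_nonneg (w_right hL ht hp.1).1 (h.μpos p (sr hp)).le, (exp_pos _).le,
          exp_le_one_iff.2 (by linarith [hp.1.1])⟩)
      (by
        filter_upwards [ae_restrict_mem (bx_meas 0 t0)] with p hp
        exact ⟨mul_nonneg (w_left hL ht hp.1).1 (h.μpos p (sl hp)).le, (exp_pos _).le,
          exp_le_one_iff.2 (by linarith [hp.1.2])⟩)
      (bx_int car) (bx_int cal)
      (fun k => bx_int (car.mul (by fun_prop))) (fun k => bx_int (car.mul (by fun_prop)))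
      (fun k => bx_int (cal.mul (by fun_prop))) (fun k => bx_int (cal.mul (by fun_prop)))
      ρ hρ0.le hρ1 n
    have bnd : ∀ j : ℕ,
        ((∫ x in (0:ℝ)..(2*π), Ut (t0, x) * cos (((j+1:ℕ):ℝ) * x)) ^ 2
      + (∫ x in (0:ℝ)..(2*π), Ut (t0, x) * sin (((j+1:ℕ):ℝ) * x)) ^ 2 -
      ((∫ x in (0:ℝ)..(2*π), Uh (t0, x) * cos (((j+1:ℕ):ℝ) * x)) ^ 2
      + (∫ x in (0:ℝ)..(2*π), Uh (t0, x) * sin (((j+1:ℕ):ℝ) * x)) ^ 2))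
      ≤ -(((∫ p in bx t0 L, (1 - ((p.1 - t0) / (L - t0)) ^ 4) * (K p * exp (U p)) * (exp (-(p.1 - t0)) ^ (j+1) * cos (((j+1:ℕ):ℝ) * p.2)))
      * (∫ p in bx 0 t0, (1 - ((t0 - p.1) / t0) ^ 4) * (K p * exp (U p)) * (exp (-(t0 - p.1)) ^ (j+1) * cos (((j+1:ℕ):ℝ) * p.2)))) +
       ((∫ p in bx t0 L, (1 - ((p.1 - t0) / (L - t0)) ^ 4) * (K p * exp (U p)) * (exp (-(p.1 - t0)) ^ (j+1) * sin (((j+1:ℕ):ℝ) * p.2)))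
      * (∫ p in bx 0 t0, (1 - ((t0 - p.1) / t0) ^ 4) * (K p * exp (U p)) * (exp (-(t0 - p.1)) ^ (j+1) * sin (((j+1:ℕ):ℝ) * p.2)))))
      + E * (1 / (((j+1:ℕ):ℝ))^2) := by
      intro j
      have ee : ∀ x : ℝ, exp (-x) ^ (j+1) = exp (-((j+1:ℕ):ℝ) * x) := by
        intro x; rw [← exp_nat_mul]; congr 1; ring
      simp only [ee]
      set k : ℝ := ((j+1:ℕ):ℝ) with hk
      have hk1 : 1 ≤ k := by rw [hk]; push_cast; linarith [(Nat.cast_nonneg j : (0:ℝ) ≤ j)]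
      have ec : cos (k * (2*π)) = 1 := by rw [hk]; exact cos_nat_mul_two_pi _
      have es : sin (k * (2*π)) = 0 := by
        rw [hk, show (((j+1:ℕ):ℝ)) * (2 * π) = ((2 * (j+1) : ℕ) : ℝ) * π by push_cast; ring]
        exact sin_nat_mul_pi _
      have dc : ∀ t, HasDerivAt (fun t => cos (k * t)) (-(k * sin (k * t))) t := fun t =>
        ((hasDerivAt_id t).const_mul k).cos.congr_deriv (by simp; ring)
      have ds : ∀ t, HasDerivAt (fun t => sin (k * t)) (k * cos (k * t)) t := fun t =>
        ((hasDerivAt_id t).const_mul k).sin.congr_deriv (by simp; ring)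
      have c1 := h.coef hD ht k hk1 (fun t => cos (k * t)) (fun t => -(k * sin (k * t))) dc
        (fun t => (((ds t).const_mul k).neg).congr_deriv (by ring)) (by simp [ec])
        (by simp [es]) (fun t => abs_cos_le_one _)
      have c2 := h.coef hD ht k hk1 (fun t => sin (k * t)) (fun t => k * cos (k * t)) ds
        (fun t => ((dc t).const_mul k).congr_deriv (by ring)) (by simp [es])
        (by simp [ec]) (fun t => abs_sin_le_one _)
      have u1 := h.uh_coef ⟨t00, t0L⟩ (fun t => cos (k * t)) (fun t => -(k * sin (k * t))) dc
        (by fun_prop) (by simp [ec])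
      have u2 := h.uh_coef ⟨t00, t0L⟩ (fun t => sin (k * t)) (fun t => (k * cos (k * t))) ds
        (by fun_prop) (by simp [es])
      have v1 : ∫ θ in (0:ℝ)..(2*π), U (t0, θ) * -(k * sin (k * θ)) = - (k * ∫ θ in (0:ℝ)..(2*π), U (t0, θ) * sin (k * θ)) := by
        rw [← intervalIntegral.integral_const_mul, ← intervalIntegral.integral_neg]; congr 1; funext θ; ring
      have v2 : ∫ θ in (0:ℝ)..(2*π), U (t0, θ) * (k * cos (k * θ)) = (k * ∫ θ in (0:ℝ)..(2*π), U (t0, θ) * cos (k * θ)) := by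
        rw [← intervalIntegral.integral_const_mul]; congr 1; funext θ; ring
      rw [← hN, ← hR] at c1 c2
      rw [v1] at u1
      rw [v2] at u2
      rw [u1, u2, hE, show 2 * (2 * N * R + R^2) * (1/k^2) = (2 * N * R + R^2)/k^2 + (2 * N * R + R^2)/k^2 by ring]
      linarith
    have nr := h.nb_right hD ht (fun p => 1) (by fun_prop) (by simp)
    have nl := h.nb_left hD ht (fun p => 1) (by fun_prop) (by simp)
    simp only [mul_one] at nr nl
    have step : ∀ j ∈ Finset.range n, ρ ^ (j+1) * ((∫ x in (0:ℝ)..(2*π), Ut (t0, x) * cos (((j+1:ℕ):ℝ) * x)) ^ 2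
      + (∫ x in (0:ℝ)..(2*π), Ut (t0, x) * sin (((j+1:ℕ):ℝ) * x)) ^ 2 -
      ((∫ x in (0:ℝ)..(2*π), Uh (t0, x) * cos (((j+1:ℕ):ℝ) * x)) ^ 2
      + (∫ x in (0:ℝ)..(2*π), Uh (t0, x) * sin (((j+1:ℕ):ℝ) * x)) ^ 2)) ≤
      E * (1 / (((j+1:ℕ):ℝ))^2) - ρ ^ (j+1) * (((∫ p in bx t0 L, (1 - ((p.1 - t0) / (L - t0)) ^ 4) * (K p * exp (U p)) * (exp (-(p.1 - t0)) ^ (j+1) * cos (((j+1:ℕ):ℝ) * p.2)))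
      * (∫ p in bx 0 t0, (1 - ((t0 - p.1) / t0) ^ 4) * (K p * exp (U p)) * (exp (-(t0 - p.1)) ^ (j+1) * cos (((j+1:ℕ):ℝ) * p.2)))) +
       ((∫ p in bx t0 L, (1 - ((p.1 - t0) / (L - t0)) ^ 4) * (K p * exp (U p)) * (exp (-(p.1 - t0)) ^ (j+1) * sin (((j+1:ℕ):ℝ) * p.2)))
      * (∫ p in bx 0 t0, (1 - ((t0 - p.1) / t0) ^ 4) * (K p * exp (U p)) * (exp (-(t0 - p.1)) ^ (j+1) * sin (((j+1:ℕ):ℝ) * p.2))))) := by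
      intro j _
      have hp0 : 0 ≤ ρ^(j+1) := by positivity
      have hp1 : ρ^(j+1) ≤ 1 := pow_le_one₀ hρ0.le hρ1.le
      have := mul_le_mul_of_nonneg_left (bnd j) hp0
      have e0 : 0 ≤ E * (1 / (((j+1:ℕ):ℝ))^2) := by positivity
      have := mul_le_mul_of_nonneg_right hp1 e0
      linarith
    refine (Finset.sum_le_sum step).trans ?_
    rw [Finset.sum_sub_distrib, ← Finset.mul_sum]
    have hs2 := mul_le_mul_of_nonneg_left (sum_sq n) E0
    have q : (∫ p in bx t0 L, (1 - ((p.1 - t0) / (L - t0)) ^ 4) * (K p * exp (U p))) *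
       (∫ p in bx 0 t0, (1 - ((t0 - p.1) / t0) ^ 4) * (K p * exp (U p))) ≤ N^2 := by
      refine (le_abs_self _).trans ?_
      rw [abs_mul, sq]
      gcongr
    have w0 : 0 ≤ 1/2 + ρ^(n+1)/(1-ρ) := by
      have : 0 < 1 - ρ := by linarith
      positivity
    have := mul_le_mul_of_nonneg_left q w0
    linarith)
  rw [le_div_iff₀ hpi]
  have := sq_nonneg (∫ θ in (0:ℝ)..(2*π), Uh (t0, θ))
  nlinarith

end Cyl

lemma fub1 {F : ℝ × ℝ → ℝ} {t₁ t₂ : ℝ} (h12 : t₁ ≤ t₂) (cF : ContinuousOn F (bx t₁ t₂)) :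
    ∫ p in bx t₁ t₂, F p = ∫ t in Set.Icc t₁ t₂, ∫ θ in (0:ℝ)..(2*π), F (t, θ) := by
  have hi := bx_int cF
  have hpi := Real.pi_pos
  have e : ∀ t, ∫ θ in (0:ℝ)..(2*π), F (t, θ) = ∫ θ in Set.Icc 0 (2*π), F (t, θ) := fun t => by
    rw [intervalIntegral.integral_of_le (by positivity), integral_Icc_eq_integral_Ioc]
  simp_rw [e]
  rw [bx, Measure.volume_eq_prod] at *
  exact setIntegral_prod _ hi

lemma fub2 {F : ℝ × ℝ → ℝ} {t₁ t₂ : ℝ} (h12 : t₁ ≤ t₂) (cF : ContinuousOn F (bx t₁ t₂)) :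
    IntervalIntegrable (fun θ => ∫ t in t₁..t₂, F (t, θ)) volume 0 (2*π) ∧
    ∫ p in bx t₁ t₂, F p = ∫ θ in (0:ℝ)..(2*π), ∫ t in t₁..t₂, F (t, θ) := by
  have hi := bx_int cF
  have hpi := Real.pi_pos
  have e : ∀ θ, ∫ t in t₁..t₂, F (t, θ) = ∫ t in Set.Icc t₁ t₂, F (t, θ) := fun t => by
    rw [intervalIntegral.integral_of_le h12, integral_Icc_eq_integral_Ioc]
  simp_rw [e]
  rw [bx, Measure.volume_eq_prod] at *
  rw [IntegrableOn, ← Measure.prod_restrict] at hi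
  constructor
  · rw [intervalIntegrable_iff_integrableOn_Icc_of_le (by positivity)]
    exact hi.integral_prod_right
  · rw [← Measure.prod_restrict, integral_prod_symm _ hi,
      intervalIntegral.integral_of_le (by positivity), integral_Icc_eq_integral_Ioc]

namespace Cyl
variable {L k0 C1 : ℝ} {U Ut Uh K : ℝ × ℝ → ℝ}

lemma good_t (h : Cyl L k0 C1 U Ut Uh K) {D : ℝ}
    (hD : ∫ p in bx 0 L, p.1 * (L - p.1) * (K p * exp (U p)) ≤ D) :
    ∃ t0 ∈ Set.Icc (L/3) (2*L/3), ∫ θ in (0:ℝ)..(2*π), K (t0, θ) * exp (U (t0, θ)) ≤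
      27 / (2 * L^3) * D + 1 := by
  have hL := h.hL
  have hpi := Real.pi_pos
  by_contra hc
  push Not at hc
  set c := 27 / (2 * L^3) * D + 1 with hcdef
  have hs : bx 0 L ⊆ strip L := bx_sub le_rfl le_rfl
  have hs2 : bx (L/3) (2*L/3) ⊆ bx 0 L := bx_mono (by linarith) (by linarith)
  have cμ := h.cμ.mono hs
  have cμ2 := cμ.mono hs2
  have q1 : |∫ p in bx (L/3) (2*L/3), K p * exp (U p)| ≤
      ∫ p in bx 0 L, 9 / (2 * L^2) * (p.1 * (L - p.1) * (K p * exp (U p))) := by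
    apply abs_int_le hs2 (bx_meas _ _) (bx_meas _ _)
    · exact bx_int (continuousOn_const.mul (ContinuousOn.mul (by fun_prop) cμ))
    · exact bx_int cμ2
    · intro p hp
      have := (h.μpos p (hs hp)).le
      have := hp.1.1
      have := sub_nonneg.2 hp.1.2
      positivity
    · intro p hp
      have m0 := (h.μpos p (hs (hs2 hp))).le
      have a1 := hp.1.1
      have a2 := hp.1.2
      have : 2 * L^2 / 9 ≤ p.1 * (L - p.1) := by nlinarith
      rw [abs_of_nonneg m0]
      calc K p * exp (U p) = 9 / (2 * L^2) * (2 * L^2 / 9 * (K p * exp (U p))) := by field_simp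
        _ ≤ _ := by gcongr
  rw [integral_const_mul] at q1
  have q2 := (le_abs_self _).trans q1
  have q3 : 0 ≤ ∫ p in bx (L/3) (2*L/3), (K p * exp (U p) - c / (2*π)) := by
    rw [fub1 (F := fun p => K p * exp (U p) - c / (2*π)) (by linarith) (cμ2.sub continuousOn_const)]
    apply setIntegral_nonneg measurableSet_Icc
    intro t ht
    have ht' : t ∈ Set.Icc 0 L := ⟨by linarith [ht.1], by linarith [ht.2]⟩
    rw [intervalIntegral.integral_sub ((h.slice h.cμ t ht').intervalIntegrable _ _)
      intervalIntegrable_const, intervalIntegral.integral_const, sub_zero, smul_eq_mul,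
      mul_div_cancel₀ _ (by positivity)]
    linarith [hc t ht]
  have vol : volume.real (bx (L/3) (2*L/3)) = (L/3) * (2 * π) := by
    rw [bx, Measure.volume_eq_prod, measureReal_prod_prod, Real.volume_real_Icc_of_le (by linarith),
      Real.volume_real_Icc_of_le (by linarith)]
    ring
  rw [integral_sub (bx_int cμ2) (bx_int continuousOn_const), setIntegral_const, vol, smul_eq_mul,
    show L / 3 * (2 * π) * (c / (2 * π)) = L/3 * c by field_simp] at q3
  have q4 : 9 / (2 * L^2) * ∫ p in bx 0 L, p.1 * (L - p.1) * (K p * exp (U p)) ≤ 9 / (2 * L^2) * D := by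
    gcongr
  have q5 : L / 3 * c = 9 / (2*L^2) * D + L/3 := by rw [hcdef]; field_simp; try ring
  linarith

lemma pohoz (h : Cyl L k0 C1 U Ut Uh K) {t₁ t₂ : ℝ} (h1 : 0 ≤ t₁) (h12 : t₁ ≤ t₂) (h2 : t₂ ≤ L) :
    ∫ p in bx t₁ t₂, -(K p * exp (U p) * Ut p) =
      (∫ θ in (0:ℝ)..(2*π), (1/2) * (Ut (t₂, θ)^2 - Uh (t₂, θ)^2)) -
      ∫ θ in (0:ℝ)..(2*π), (1/2) * (Ut (t₁, θ)^2 - Uh (t₁, θ)^2) := by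
  have hs := bx_sub h1 h2
  have ct := h.ct.mono hs
  have ch := h.ch.mono hs
  have cμ := h.cμ.mono hs
  apply div_box (fun p => (1/2) * (Ut p^2 - Uh p^2)) (fun p => Uh p * Ut p) _ t₁ t₂ h12
    (continuousOn_const.mul ((ct.pow 2).sub (ch.pow 2))) (ch.mul ct) ((cμ.mul ct).neg)
  · intro p hp
    have hp' : p.1 ∈ Set.Ioo 0 L := ⟨h1.trans_lt hp.1, hp.2.trans_le h2⟩
    obtain ⟨A, B, C, hA, hC, hAC⟩ := h.d2 p hp'
    refine ⟨_, _, ((hA.pow 2).sub (hC.pow 2)).const_mul (1/2), hC.mul hA, ?_⟩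
    simp
    linear_combination (Ut p) * hAC
  · intro t ht
    have ht' : t ∈ Set.Icc 0 L := ⟨h1.trans ht.1, ht.2.trans h2⟩
    have q1 := h.pt t ht' 0
    have q2 := h.ph t ht' 0
    rw [zero_add] at q1 q2
    simp only [q1, q2]

lemma low (h : Cyl L k0 C1 U Ut Uh K) {t0 : ℝ} (ht : t0 ∈ Set.Icc (L/3) (2*L/3)) :
    (∫ θ in (0:ℝ)..(2*π), (1/2) * (Ut (0, θ)^2 - Uh (0, θ)^2)) ≤
    (∫ θ in (0:ℝ)..(2*π), (1/2) * (Ut (t0, θ)^2 - Uh (t0, θ)^2)) +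
     ∫ θ in (0:ℝ)..(2*π), K (t0, θ) * exp (U (t0, θ)) := by
  have hL := h.hL
  have hpi := Real.pi_pos
  have h1 : 0 ≤ t0 := by linarith [ht.1]
  have h2 : t0 ≤ L := by linarith [ht.2]
  have ht' : t0 ∈ Set.Icc 0 L := ⟨h1, h2⟩
  have p := h.pohoz le_rfl h1 h2
  rw [integral_neg] at p
  have hs : bx 0 t0 ⊆ strip L := bx_sub le_rfl h2
  obtain ⟨i, e⟩ := fub2 (F := fun p => K p * exp (U p) * Ut p) h1 ((h.cμ.mono hs).mul (h.ct.mono hs))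
  have key : ∫ θ in (0:ℝ)..(2*π), ∫ t in (0:ℝ)..t0, K (t, θ) * exp (U (t, θ)) * Ut (t, θ) ≤
      ∫ θ in (0:ℝ)..(2*π), K (t0, θ) * exp (U (t0, θ)) := by
    apply intervalIntegral.integral_mono_on (by positivity) i
      ((h.slice h.cμ t0 ht').intervalIntegrable _ _)
    intro θ _
    have hsub : Set.Icc 0 t0 ⊆ Set.Icc 0 L := Set.Icc_subset_Icc le_rfl h2
    have cU := (h.slice' h.cU θ).mono hsub
    have cE : ContinuousOn (fun t => exp (U (t, θ))) (Set.Icc 0 t0) := continuous_exp.comp_continuousOn cU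
    have := stieltjes (fun t => K (t, θ)) (fun t => exp (U (t, θ))) (fun t => exp (U (t, θ)) * Ut (t, θ))
      0 t0 h1 ((h.slice' h.cK θ).mono hsub) ((h.mK θ).mono hsub) cE
      (cE.mul ((h.slice' h.ct θ).mono hsub))
      (fun x hx => (dslice1 (h.dU (x, θ) ⟨hx.1, hx.2.trans_le h2⟩)).exp) (fun x _ => exp_pos _)
    simp only [← mul_assoc] at this
    have := h.μpos (0, θ) ⟨⟨le_rfl, hL.le⟩, trivial⟩
    linarith
  linarith

lemma high (h : Cyl L k0 C1 U Ut Uh K) (hC : 0 ≤ C1) {t0 : ℝ} (ht : t0 ∈ Set.Icc (L/3) (2*L/3)) :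
    (∫ θ in (0:ℝ)..(2*π), (1/2) * (Ut (L, θ)^2 - Uh (L, θ)^2)) ≤
    (∫ θ in (0:ℝ)..(2*π), (1/2) * (Ut (t0, θ)^2 - Uh (t0, θ)^2)) +
     (∫ θ in (0:ℝ)..(2*π), K (t0, θ) * exp (U (t0, θ))) + C1 * ∫ p in bx 0 L, K p * exp (U p) := by
  have hL := h.hL
  have hpi := Real.pi_pos
  have h1 : 0 ≤ t0 := by linarith [ht.1]
  have h2 : t0 ≤ L := by linarith [ht.2]
  have ht' : t0 ∈ Set.Icc 0 L := ⟨h1, h2⟩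
  have p := h.pohoz h1 h2 le_rfl
  have hs : bx t0 L ⊆ strip L := bx_sub h1 le_rfl
  have hs0 : bx 0 L ⊆ strip L := bx_sub le_rfl le_rfl
  have cμ := h.cμ.mono hs
  have ct := h.ct.mono hs
  have c1 : ContinuousOn (fun p => -(K p * exp (U p) * Ut p) - C1 * (K p * exp (U p))) (bx t0 L) :=
    (cμ.mul ct).neg.sub (continuousOn_const.mul cμ)
  obtain ⟨i, e⟩ := fub2 h2 c1
  have key : ∫ θ in (0:ℝ)..(2*π), ∫ t in t0..L, (-(K (t, θ) * exp (U (t, θ)) * Ut (t, θ)) - C1 * (K (t, θ) * exp (U (t, θ)))) ≤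
      ∫ θ in (0:ℝ)..(2*π), K (t0, θ) * exp (U (t0, θ)) := by
    apply intervalIntegral.integral_mono_on (by positivity) i
      ((h.slice h.cμ t0 ht').intervalIntegrable _ _)
    intro θ _
    have hsub : Set.Icc t0 L ⊆ Set.Icc 0 L := Set.Icc_subset_Icc h1 le_rfl
    have cU := (h.slice' h.cU θ).mono hsub
    have cE : ContinuousOn (fun t => exp (C1 * t + U (t, θ))) (Set.Icc t0 L) :=
      continuous_exp.comp_continuousOn (ContinuousOn.add (by fun_prop) cU)
    have := stieltjes (fun t => -(K (t, θ) * exp (-(C1 * t)))) (fun t => exp (C1 * t + U (t, θ)))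
      (fun t => exp (C1 * t + U (t, θ)) * (C1 + Ut (t, θ)))
      t0 L h2 ((((h.slice' h.cK θ).mono hsub).mul (by fun_prop)).neg) (by
        intro s hs t ht2 hst
        have := h.aK θ s t (by linarith [ht.1, hs.1]) hst ht2.2
        simp only [neg_le_neg_iff]
        calc K (t, θ) * exp (-(C1 * t)) ≤ (exp (C1 * (t - s)) * K (s, θ)) * exp (-(C1 * t)) := by
              gcongr
          _ = K (s, θ) * (exp (C1 * (t - s)) * exp (-(C1 * t))) := by ring
          _ = _ := by rw [← exp_add]; congr 2; ring) cE
      (cE.mul (continuousOn_const.add ((h.slice' h.ct θ).mono hsub)))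
      (fun x hx => by
        have d1 := dslice1 (h.dU (x, θ) ⟨h1.trans_lt hx.1, hx.2⟩)
        have d2 : HasDerivAt (fun t : ℝ => C1 * t) C1 x := by
          simpa using (hasDerivAt_id x).const_mul C1
        exact (d2.add d1).exp) (fun x _ => exp_pos _)
    have ee : ∀ t : ℝ, exp (-(C1 * t)) * exp (C1 * t + U (t, θ)) = exp (U (t, θ)) := by
      intro t; rw [← exp_add]; congr 1; ring
    have e2 : (fun t : ℝ => -(K (t, θ) * exp (-(C1 * t))) * (exp (C1 * t + U (t, θ)) * (C1 + Ut (t, θ))))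
       = fun t => (-(K (t, θ) * exp (U (t, θ)) * Ut (t, θ)) - C1 * (K (t, θ) * exp (U (t, θ)))) := by
      funext t
      rw [← ee t]; ring
    have e3 : ∀ t : ℝ, -(K (t, θ) * exp (-(C1 * t))) * exp (C1 * t + U (t, θ)) = -(K (t, θ) * exp (U (t, θ))) := by
      intro t; rw [← ee t]; ring
    rw [e2, e3, e3] at this
    have := h.μpos (L, θ) ⟨⟨hL.le, le_rfl⟩, trivial⟩
    linarith
  have j1 : IntegrableOn (fun p => -(K p * exp (U p) * Ut p)) (bx t0 L) := bx_int (cμ.mul ct).neg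
  have j2 : IntegrableOn (fun p => C1 * (K p * exp (U p))) (bx t0 L) := bx_int (continuousOn_const.mul cμ)
  rw [integral_sub j1 j2, integral_const_mul] at e
  have mono : ∫ p in bx t0 L, K p * exp (U p) ≤ ∫ p in bx 0 L, K p * exp (U p) :=
    setIntegral_mono_set (bx_int (h.cμ.mono hs0)) (by
      filter_upwards [ae_restrict_mem (bx_meas 0 L)] with p hp using (h.μpos p (hs0 hp)).le)
      (Filter.Eventually.of_forall (bx_mono h1 le_rfl))
  have := mul_le_mul_of_nonneg_left mono hC
  linarith

lemma cs {f : ℝ → ℝ} (hf : Continuous f) :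
    (∫ x in (0:ℝ)..(2*π), f x)^2 ≤ 2 * π * ∫ x in (0:ℝ)..(2*π), f x ^ 2 := by
  have := (parseval_real f hf).nonneg (fun j => by positivity)
  linarith

theorem mass (L k0 C1 : ℝ) (hC : 0 ≤ C1) : ∃ M0 : ℝ, ∀ (U Ut Uh K : ℝ × ℝ → ℝ),
    Cyl L k0 C1 U Ut Uh K → ∫ p in bx 0 L, K p * exp (U p) ≤ M0 := by
  have hpi := Real.pi_pos
  obtain ⟨D, D0, hD⟩ := wmass L k0
  obtain ⟨Q, hQ⟩ := pbound L k0
  set q := Q / 2 + (27 / (2 * L^3) * D + 1) with hq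
  refine ⟨1 + 16 * π * |q| + 8 * π * C1, ?_⟩
  intro U Ut Uh K h
  have hL := h.hL
  have hD := hD C1 U Ut Uh K h
  obtain ⟨t0, ht, hg⟩ := h.good_t hD
  have ht' : t0 ∈ Set.Icc 0 L := ⟨by linarith [ht.1], by linarith [ht.2]⟩
  have hQ := hQ C1 U Ut Uh K h t0 ht
  have lo := h.low ht
  have hi := h.high hC ht
  have e0 : ∫ θ in (0:ℝ)..(2*π), (1/2) * (Ut (t0, θ)^2 - Uh (t0, θ)^2) =
      1/2 * ((∫ θ in (0:ℝ)..(2*π), Ut (t0, θ)^2) - (∫ θ in (0:ℝ)..(2*π), Uh (t0, θ)^2)) := by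
    rw [intervalIntegral.integral_const_mul, intervalIntegral.integral_sub]
    · exact ((h.slice h.ct t0 ht').pow 2).intervalIntegrable _ _
    · exact ((h.slice h.ch t0 ht').pow 2).intervalIntegrable _ _
  simp only [h.h0, h.hhL, e0, intervalIntegral.integral_const_mul] at lo hi
  simp only [ne_eq, OfNat.ofNat_ne_zero, not_false_eq_true, zero_pow, sub_zero] at lo hi
  have c0 := cs (h.slice h.ct 0 ⟨le_rfl, hL.le⟩)
  have cL := cs (h.slice h.ct L ⟨hL.le, le_rfl⟩)
  have f1 := h.flux_in
  have f2 := h.flux_out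
  have hs : bx 0 L ⊆ strip L := bx_sub le_rfl le_rfl
  have cμ := h.cμ.mono hs
  have i1 : IntegrableOn (fun p : ℝ × ℝ => (L - p.1) * (K p * exp (U p))) (bx 0 L) :=
    bx_int (ContinuousOn.mul (by fun_prop) cμ)
  have i2 : IntegrableOn (fun p : ℝ × ℝ => p.1 * (K p * exp (U p))) (bx 0 L) :=
    bx_int (ContinuousOn.mul (by fun_prop) cμ)
  have f3 : L * ∫ p in bx 0 L, K p * exp (U p) = (∫ p in bx 0 L, (L - p.1) * (K p * exp (U p)))
      + ∫ p in bx 0 L, p.1 * (K p * exp (U p)) := by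
    rw [← integral_add i1 i2, ← integral_const_mul]
    congr 1; funext p; ring
  have M0 : 0 ≤ ∫ p in bx 0 L, K p * exp (U p) :=
    setIntegral_nonneg (bx_meas _ _) (fun p hp => (h.μpos p (hs hp)).le)
  generalize (∫ p in bx 0 L, K p * exp (U p)) = M at *
  have f4 : M = (∫ θ in (0:ℝ)..(2*π), Ut (0, θ)) - ∫ θ in (0:ℝ)..(2*π), Ut (L, θ) := by
    apply mul_left_cancel₀ hL.ne'
    rw [f3, mul_sub, f1, f2]; ring
  generalize (∫ θ in (0:ℝ)..(2*π), Ut (0, θ)) = a at *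
  generalize (∫ θ in (0:ℝ)..(2*π), Ut (L, θ)) = b at *
  have hqa := le_abs_self q
  have a2 : a^2 ≤ 4 * π * |q| := by
    refine c0.trans ?_
    have : ∫ x in (0:ℝ)..(2*π), Ut (0, x)^2 ≤ 2 * |q| := by linarith
    nlinarith [mul_le_mul_of_nonneg_left this hpi.le]
  have b2 : b^2 ≤ 4 * π * (|q| + C1 * M) := by
    refine cL.trans ?_
    have : ∫ x in (0:ℝ)..(2*π), Ut (L, x)^2 ≤ 2 * (|q| + C1 * M) := by linarith
    nlinarith [mul_le_mul_of_nonneg_left this hpi.le]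
  have M2 : M^2 ≤ 16 * π * |q| + 8 * π * C1 * M := by
    rw [f4] at *
    nlinarith [sq_nonneg (a + b)]
  by_contra hc
  push Not at hc
  have x1 : 0 ≤ 16 * π * |q| := by positivity
  have x2 : 0 ≤ 8 * π * C1 := by positivity
  nlinarith

end Cyl

/-- first basis vector -/
def ea : E2 := EuclideanSpace.single 0 1
/-- second basis vector -/
def eb : E2 := EuclideanSpace.single 1 1

/-- polar parametrization -/
def pol (r θ : ℝ) : E2 := (r * cos θ) • ea + (r * sin θ) • eb

/-- cylinder parametrization -/
def cX (p : ℝ × ℝ) : E2 := pol (exp p.1 / 2) p.2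
/-- rotated cylinder parametrization -/
def cY (p : ℝ × ℝ) : E2 := (-(exp p.1 / 2 * sin p.2)) • ea + (exp p.1 / 2 * cos p.2) • eb

lemma pol_0 (r θ : ℝ) : (pol r θ) 0 = r * cos θ := by simp [pol, ea, eb]
lemma pol_1 (r θ : ℝ) : (pol r θ) 1 = r * sin θ := by simp [pol, ea, eb]

lemma norm_pol {r : ℝ} (hr : 0 ≤ r) (θ : ℝ) : ‖pol r θ‖ = r := by
  rw [EuclideanSpace.norm_eq, Fin.sum_univ_two, pol_0, pol_1]
  simp only [Real.norm_eq_abs, sq_abs]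
  rw [show (r * cos θ)^2 + (r * sin θ)^2 = r^2 * (cos θ^2 + sin θ^2) by ring, cos_sq_add_sin_sq, mul_one,
    sqrt_sq hr]

lemma norm_cX (p : ℝ × ℝ) : ‖cX p‖ = exp p.1 / 2 := norm_pol (by positivity) _

lemma cX_cont : Continuous cX := by unfold cX pol; fun_prop
lemma cX_smooth : ContDiff ℝ 2 cX := by unfold cX pol; fun_prop

lemma hasFDerivAt_cX (p : ℝ × ℝ) : HasFDerivAt cX
    ((ContinuousLinearMap.fst ℝ ℝ ℝ).smulRight (cX p) + (ContinuousLinearMap.snd ℝ ℝ ℝ).smulRight (cY p)) p := by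
  have h1 : HasFDerivAt (fun p : ℝ × ℝ => exp p.1 / 2) ((exp p.1 / 2) • ContinuousLinearMap.fst ℝ ℝ ℝ) p := by
    have := ((Real.hasDerivAt_exp p.1).div_const 2).comp_hasFDerivAt p (hasFDerivAt_fst (𝕜 := ℝ) (E := ℝ) (F := ℝ) (p := p))
    exact this
  have h2 : HasFDerivAt (fun p : ℝ × ℝ => cos p.2) ((-sin p.2) • ContinuousLinearMap.snd ℝ ℝ ℝ) p :=
    (Real.hasDerivAt_cos p.2).comp_hasFDerivAt p (hasFDerivAt_snd (𝕜 := ℝ) (E := ℝ) (F := ℝ) (p := p))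
  have h3 : HasFDerivAt (fun p : ℝ × ℝ => sin p.2) ((cos p.2) • ContinuousLinearMap.snd ℝ ℝ ℝ) p :=
    (Real.hasDerivAt_sin p.2).comp_hasFDerivAt p (hasFDerivAt_snd (𝕜 := ℝ) (E := ℝ) (F := ℝ) (p := p))
  refine (((h1.mul h2).smul_const ea).add ((h1.mul h3).smul_const eb)).congr_fderiv ?_
  ext v i <;> simp [cX, cY, pol] <;> ring

lemma hasFDerivAt_cY (p : ℝ × ℝ) : HasFDerivAt cY
    ((ContinuousLinearMap.fst ℝ ℝ ℝ).smulRight (cY p) - (ContinuousLinearMap.snd ℝ ℝ ℝ).smulRight (cX p)) p := by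
  have h1 : HasFDerivAt (fun p : ℝ × ℝ => exp p.1 / 2) ((exp p.1 / 2) • ContinuousLinearMap.fst ℝ ℝ ℝ) p := by
    have := ((Real.hasDerivAt_exp p.1).div_const 2).comp_hasFDerivAt p (hasFDerivAt_fst (𝕜 := ℝ) (E := ℝ) (F := ℝ) (p := p))
    exact this
  have h2 : HasFDerivAt (fun p : ℝ × ℝ => cos p.2) ((-sin p.2) • ContinuousLinearMap.snd ℝ ℝ ℝ) p :=
    (Real.hasDerivAt_cos p.2).comp_hasFDerivAt p (hasFDerivAt_snd (𝕜 := ℝ) (E := ℝ) (F := ℝ) (p := p))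
  have h3 : HasFDerivAt (fun p : ℝ × ℝ => sin p.2) ((cos p.2) • ContinuousLinearMap.snd ℝ ℝ ℝ) p :=
    (Real.hasDerivAt_sin p.2).comp_hasFDerivAt p (hasFDerivAt_snd (𝕜 := ℝ) (E := ℝ) (F := ℝ) (p := p))
  refine ((((h1.mul h3).neg).smul_const ea).add ((h1.mul h2).smul_const eb)).congr_fderiv ?_
  ext v i <;> simp [cX, cY, pol] <;> ring

lemma Omega_open : IsOpen Omega :=
  (isOpen_lt continuous_const continuous_norm).inter (isOpen_lt continuous_norm continuous_const)

lemma exp_L : exp (log 2) = 2 := exp_log (by norm_num)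

lemma cX_mem_Omega {p : ℝ × ℝ} (hp : p.1 ∈ Set.Ioo 0 (log 2)) : cX p ∈ Omega := by
  have h1 : 1 < exp p.1 := by rw [← exp_zero]; exact exp_lt_exp.2 hp.1
  have h2 : exp p.1 < 2 := by rw [← exp_L]; exact exp_lt_exp.2 hp.2
  refine ⟨?_, ?_⟩ <;> rw [norm_cX] <;> linarith

lemma cX_mem_closure {p : ℝ × ℝ} (hp : p ∈ strip (log 2)) : cX p ∈ closure Omega := by
  have hL : (0:ℝ) < log 2 := log_pos (by norm_num)
  have : p ∈ closure (Set.Ioo 0 (log 2) ×ˢ (Set.univ : Set ℝ)) := by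
    rw [closure_prod_eq, closure_Ioo hL.ne, closure_univ]; exact hp
  exact map_mem_closure cX_cont this (fun q hq => cX_mem_Omega hq.1)

lemma cX_frontier0 (θ : ℝ) : cX (0, θ) ∈ frontier Omega := by
  have hL : (0:ℝ) < log 2 := log_pos (by norm_num)
  rw [Omega_open.frontier_eq]
  refine ⟨cX_mem_closure ⟨⟨le_rfl, hL.le⟩, trivial⟩, fun h => ?_⟩
  have := h.1
  rw [norm_cX] at this
  simp at this

lemma cX_frontierL (θ : ℝ) : cX (log 2, θ) ∈ frontier Omega := by
  have hL : (0:ℝ) < log 2 := log_pos (by norm_num)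
  rw [Omega_open.frontier_eq]
  refine ⟨cX_mem_closure ⟨⟨hL.le, le_rfl⟩, trivial⟩, fun h => ?_⟩
  have := h.2
  rw [norm_cX] at this
  simp only [exp_L] at this
  norm_num at this

lemma cX_per (t θ : ℝ) : cX (t, θ + 2 * π) = cX (t, θ) := by simp [cX, pol]

lemma cX_scale (s t θ : ℝ) : cX (t, θ) = exp (t - s) • cX (s, θ) := by
  simp only [cX, pol, smul_add, smul_smul]
  have : exp t = exp (t - s) * exp s := by rw [← exp_add]; congr 1; ring
  rw [this]
  congr 2 <;> ring

lemma dist_cX {s t : ℝ} (hst : s ≤ t) (θ : ℝ) : ‖cX (t, θ) - cX (s, θ)‖ = exp t / 2 - exp s / 2 := by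
  rw [cX_scale s t θ]
  have : exp (t - s) • cX (s, θ) - cX (s, θ) = (exp (t - s) - 1) • cX (s, θ) := by rw [sub_smul, one_smul]
  rw [this, norm_smul, norm_cX, Real.norm_eq_abs, abs_of_nonneg (by linarith [add_one_le_exp (t - s)])]
  have : exp t = exp (t - s) * exp s := by rw [← exp_add]; congr 1; ring
  rw [this]; ring

/-- the weight -/
def cK (β : ℝ) (x₀ : E2) (V : E2 → ℝ) (p : ℝ × ℝ) : ℝ :=
  exp (2 * p.1) / 4 * ((1 + ‖cX p - x₀‖ ^ (2 * β)) * V (cX p))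

lemma norm_mono {x₀ x : E2} {l : ℝ} (hl : 1 ≤ l) (h : ‖x₀‖ ≤ ‖x‖) : ‖x - x₀‖ ≤ ‖l • x - x₀‖ := by
  have e : l • x - x₀ = (x - x₀) + (l - 1) • x := by rw [sub_smul, one_smul]; abel
  have h2 : ‖x - x₀‖^2 ≤ ‖l • x - x₀‖^2 := by
    rw [e, norm_add_sq_real, inner_smul_right, inner_sub_left, real_inner_self_eq_norm_sq]
    have := real_inner_le_norm x₀ x
    have h3 : 0 ≤ ‖x‖^2 - ⟪x₀, x⟫ := by nlinarith [norm_nonneg x]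
    have h4 : 0 ≤ l - 1 := by linarith
    have := mul_nonneg h4 h3
    nlinarith [sq_nonneg ‖(l - 1) • x‖]
  exact le_of_sq_le_sq h2 (norm_nonneg _)

section
variable {β a b : ℝ} {x₀ : E2} {V : E2 → ℝ}

lemma V_lip (ha : 0 < a) (hβ : 0 < β)
    (hV : LipschitzOnWith (Real.toNNReal (a / (2 * (1 + (2:ℝ) ^ (2 * β))))) V (closure Omega))
    {s t : ℝ} (θ : ℝ) (h0 : 0 ≤ s) (hst : s ≤ t) (h1 : t ≤ log 2) :
    |V (cX (t, θ)) - V (cX (s, θ))| ≤ a / 4 * (exp t / 2 - exp s / 2) := by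
  have := hV.dist_le_mul (cX (t, θ)) (cX_mem_closure ⟨⟨h0.trans hst, h1⟩, trivial⟩)
    (cX (s, θ)) (cX_mem_closure ⟨⟨h0, hst.trans h1⟩, trivial⟩)
  rw [Real.dist_eq, dist_eq_norm, dist_cX hst] at this
  refine this.trans ?_
  have hp : (1:ℝ) ≤ 2 ^ (2 * β) := Real.one_le_rpow (by norm_num) (by linarith)
  have he := exp_le_exp.2 hst
  have h0 : 0 ≤ exp t / 2 - exp s / 2 := by linarith
  gcongr
  rw [Real.coe_toNNReal _ (by positivity)]
  gcongr
  linarith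

lemma cK_cont (ha : 0 < a) (hβ : 0 < β)
    (hV : LipschitzOnWith (Real.toNNReal (a / (2 * (1 + (2:ℝ) ^ (2 * β))))) V (closure Omega)) :
    ContinuousOn (cK β x₀ V) (strip (log 2)) := by
  have h1 : ContinuousOn (fun p => V (cX p)) (strip (log 2)) :=
    hV.continuousOn.comp cX_cont.continuousOn (fun p hp => cX_mem_closure hp)
  have h2 : Continuous (fun p : ℝ × ℝ => ‖cX p - x₀‖ ^ (2 * β)) :=
    (cX_cont.sub continuous_const).norm.rpow_const (fun p => Or.inr (by linarith))
  have h3 : Continuous (fun p : ℝ × ℝ => exp (2 * p.1) / 4) := by fun_prop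
  exact h3.continuousOn.mul ((continuous_const.add h2).continuousOn.mul h1)

lemma cK_low (ha : 0 < a) (hV : ∀ x ∈ closure Omega, a ≤ V x ∧ V x ≤ b) (p : ℝ × ℝ)
    (hp : p ∈ strip (log 2)) : exp (2 * p.1) / 4 * a ≤ cK β x₀ V p := by
  have h1 := (hV _ (cX_mem_closure hp)).1
  have h2 : 0 ≤ ‖cX p - x₀‖ ^ (2 * β) := by positivity
  unfold cK
  gcongr
  nlinarith

lemma cK_mono (ha : 0 < a) (hβ : 0 < β) (hx : ‖x₀‖ = 1/2)
    (hV : LipschitzOnWith (Real.toNNReal (a / (2 * (1 + (2:ℝ) ^ (2 * β))))) V (closure Omega))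
    (hab : ∀ x ∈ closure Omega, a ≤ V x ∧ V x ≤ b) (θ : ℝ) :
    MonotoneOn (fun t => cK β x₀ V (t, θ)) (Set.Icc 0 (log 2)) := by
  intro s hs t ht hst
  have hl := (abs_le.1 (V_lip ha hβ hV θ hs.1 hst ht.2)).1
  have h1 := (hab _ (cX_mem_closure (p := (s, θ)) ⟨hs, trivial⟩)).1
  have h2 := (hab _ (cX_mem_closure (p := (t, θ)) ⟨ht, trivial⟩)).1
  have es : 1 ≤ exp s := one_le_exp hs.1
  have est := exp_le_exp.2 hst
  have et : exp t ≤ 2 := by rw [← exp_L]; exact exp_le_exp.2 ht.2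
  have hn : ‖cX (s, θ) - x₀‖ ≤ ‖cX (t, θ) - x₀‖ := by
    rw [cX_scale s t θ]
    apply norm_mono (one_le_exp (by linarith))
    rw [hx, norm_cX]; simp only; linarith
  have hr : ‖cX (s, θ) - x₀‖ ^ (2 * β) ≤ ‖cX (t, θ) - x₀‖ ^ (2 * β) :=
    Real.rpow_le_rpow (norm_nonneg _) hn (by linarith)
  have key : exp (2 * s) / 4 * V (cX (s, θ)) ≤ exp (2 * t) / 4 * V (cX (t, θ)) := by
    have e1 : ∀ x : ℝ, exp (2 * x) = exp x ^ 2 := fun x => by rw [← exp_nat_mul]; norm_num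
    rw [e1, e1]
    generalize exp s = x at *
    generalize exp t = y at *
    generalize V (cX (s, θ)) = v at *
    generalize V (cX (t, θ)) = w at *
    have hw : v * (1 - (y - x) / 8) ≤ w := by nlinarith
    have hxy : x^2 ≤ y^2 * (1 - (y - x) / 8) := by
      have : y^2 * (y - x) / 8 ≤ (y - x) * (y + x) := by nlinarith [mul_nonneg (sub_nonneg.2 est) (by nlinarith : 0 ≤ (y + x) * 8 - y^2)]
      nlinarith
    have v0' : 0 ≤ v := by linarith
    calc x^2/4 * v ≤ (y^2 * (1 - (y - x) / 8))/4 * v := by gcongr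
      _ = y^2/4 * (v * (1 - (y - x) / 8)) := by ring
      _ ≤ _ := by gcongr
  have v0 : 0 ≤ exp (2 * s) / 4 * V (cX (s, θ)) := mul_nonneg (by positivity) (by linarith)
  have n0 : 0 ≤ ‖cX (s, θ) - x₀‖ ^ (2 * β) := by positivity
  calc cK β x₀ V (s, θ) = (exp (2 * s) / 4 * V (cX (s, θ))) * (1 + ‖cX (s, θ) - x₀‖ ^ (2 * β)) := by
        unfold cK; ring
    _ ≤ (exp (2 * t) / 4 * V (cX (t, θ))) * (1 + ‖cX (t, θ) - x₀‖ ^ (2 * β)) := by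
        gcongr
        exact v0.trans key
    _ = _ := by unfold cK; ring

lemma cK_growth (ha : 0 < a) (hβ : 0 < β) (hβ2 : β < 1/2) (hx : ‖x₀‖ = 1/2)
    (hV : LipschitzOnWith (Real.toNNReal (a / (2 * (1 + (2:ℝ) ^ (2 * β))))) V (closure Omega))
    (hab : ∀ x ∈ closure Omega, a ≤ V x ∧ V x ≤ b) (θ s t : ℝ) (hs : log 2 / 3 ≤ s) (hst : s ≤ t)
    (ht : t ≤ log 2) : cK β x₀ V (t, θ) ≤ exp (11 * (t - s)) * cK β x₀ V (s, θ) := by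
  have hL : (0:ℝ) < log 2 := log_pos (by norm_num)
  have s0 : 0 ≤ s := by linarith
  have hl := (abs_le.1 (V_lip ha hβ hV θ s0 hst ht)).2
  have h1 := (hab _ (cX_mem_closure (p := (s, θ)) ⟨⟨s0, hst.trans ht⟩, trivial⟩)).1
  have est := exp_le_exp.2 hst
  have et : exp t ≤ 2 := by rw [← exp_L]; exact exp_le_exp.2 ht
  have es : 5/4 ≤ exp s := by
    rw [← log_le_iff_le_exp (by norm_num)]
    have : (3:ℕ) * log (5/4) ≤ log 2 := by
      rw [← log_pow]; apply log_le_log <;> norm_num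
    push_cast at this
    linarith
  have d : exp t / 2 - exp s / 2 ≤ t - s := by
    have := add_one_le_exp (-(t - s))
    have e : exp s = exp t * exp (-(t - s)) := by rw [← exp_add]; congr 1; ring
    rw [e]
    nlinarith [exp_pos t]
  have d0 : 0 ≤ t - s := by linarith
  have hv : V (cX (t, θ)) ≤ exp (t - s) * V (cX (s, θ)) := by
    have := add_one_le_exp (t - s)
    nlinarith
  have hn : ‖cX (t, θ) - x₀‖ ≤ ‖cX (s, θ) - x₀‖ * exp (8 * (t - s)) := by
    have q1 : ‖cX (t, θ) - x₀‖ ≤ ‖cX (t, θ) - cX (s, θ)‖ + ‖cX (s, θ) - x₀‖ := norm_sub_le_norm_sub_add_norm_sub _ _ _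
    rw [dist_cX hst] at q1
    have q2 : 1/8 ≤ ‖cX (s, θ) - x₀‖ := by
      have := norm_sub_norm_le (cX (s, θ)) x₀
      rw [hx, norm_cX] at this
      simp only at this
      linarith
    have := add_one_le_exp (8 * (t - s))
    nlinarith
  have hr : ‖cX (t, θ) - x₀‖ ^ (2 * β) ≤ ‖cX (s, θ) - x₀‖ ^ (2 * β) * exp (8 * (t - s)) := by
    refine (Real.rpow_le_rpow (norm_nonneg _) hn (by linarith)).trans ?_
    rw [Real.mul_rpow (norm_nonneg _) (exp_pos _).le, ← exp_mul]
    have q : 8 * (t - s) * (2 * β) ≤ 8 * (t - s) := by nlinarith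
    exact mul_le_mul_of_nonneg_left (exp_le_exp.2 q) (by positivity)
  have e8 : 1 ≤ exp (8 * (t - s)) := one_le_exp (by linarith)
  have ee : exp (11 * (t - s)) * (exp (2 * s) / 4) = exp (2 * t) / 4 * (exp (8 * (t - s)) * exp (t - s)) := by
    rw [show exp (11 * (t - s)) * (exp (2 * s) / 4) = (exp (11 * (t - s)) * exp (2 * s)) / 4 by ring,
      show exp (2 * t) / 4 * (exp (8 * (t - s)) * exp (t - s)) = exp (2 * t) * exp (8 * (t - s)) * exp (t - s) / 4 by ring,
      ← exp_add, ← exp_add, ← exp_add]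
    congr 2; ring
  have v0 : 0 ≤ V (cX (s, θ)) := by linarith
  have n0 : 0 ≤ ‖cX (t, θ) - x₀‖ ^ (2 * β) := by positivity
  have n1 : 0 ≤ ‖cX (s, θ) - x₀‖ ^ (2 * β) := by positivity
  calc cK β x₀ V (t, θ) = exp (2 * t) / 4 * ((1 + ‖cX (t, θ) - x₀‖ ^ (2 * β)) * V (cX (t, θ))) := rfl
    _ ≤ exp (2 * t) / 4 * ((exp (8 * (t - s)) * (1 + ‖cX (s, θ) - x₀‖ ^ (2 * β))) * (exp (t - s) * V (cX (s, θ)))) := by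
        have w0 : 0 ≤ V (cX (t, θ)) :=
          ha.le.trans (hab _ (cX_mem_closure (p := (t, θ)) ⟨⟨s0.trans hst, ht⟩, trivial⟩)).1
        refine mul_le_mul_of_nonneg_left (mul_le_mul ?_ hv w0 (by positivity)) (by positivity)
        linarith
    _ = (exp (2 * t) / 4 * (exp (8 * (t - s)) * exp (t - s))) * ((1 + ‖cX (s, θ) - x₀‖ ^ (2 * β)) * V (cX (s, θ))) := by ring
    _ = _ := by rw [← ee]; unfold cK; ring
end

lemma strip_ud (L : ℝ) (hL : 0 < L) : UniqueDiffOn ℝ (strip L) :=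
  (uniqueDiffOn_Icc hL).prod uniqueDiffOn_univ

section
variable {β a b : ℝ} {x₀ : E2} {V u : E2 → ℝ}

lemma L_pos : (0:ℝ) < log 2 := log_pos (by norm_num)

lemma lap_eq (u : E2 → ℝ) (x : E2) :
    lap u x = fderiv ℝ (fderiv ℝ u) x ea ea + fderiv ℝ (fderiv ℝ u) x eb eb := by
  simp [lap, Fin.sum_univ_two, iteratedFDeriv_two_apply, ea, eb]

lemma bil_sum (H : E2 →L[ℝ] E2 →L[ℝ] ℝ) (p : ℝ × ℝ) (hs : ∀ v w, H v w = H w v) :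
    H (cX p) (cX p) + H (cY p) (cY p) = exp (2 * p.1) / 4 * (H ea ea + H eb eb) := by
  have e1 : exp (2 * p.1) = exp p.1 ^ 2 := by rw [← exp_nat_mul]; norm_num
  have e2 := sin_sq_add_cos_sq p.2
  simp only [cX, cY, pol, map_add, map_smul, ContinuousLinearMap.add_apply,
    ContinuousLinearMap.smul_apply, smul_eq_mul]
  rw [hs eb ea, e1]
  linear_combination (exp p.1 ^ 2 / 4 * (H ea ea + H eb eb)) * e2

lemma U_smooth (hu : ContDiffOn ℝ 2 u (closure Omega)) :
    ContDiffOn ℝ 2 (fun p => u (cX p)) (strip (log 2)) :=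
  hu.comp cX_smooth.contDiffOn (fun p hp => cX_mem_closure hp)

/-- derivative of the lifted function -/
def dU (u : E2 → ℝ) (p : ℝ × ℝ) : ℝ × ℝ →L[ℝ] ℝ :=
  fderivWithin ℝ (fun p => u (cX p)) (strip (log 2)) p

lemma dU_cont (hu : ContDiffOn ℝ 2 u (closure Omega)) : ContinuousOn (dU u) (strip (log 2)) :=
  (U_smooth hu).continuousOn_fderivWithin (strip_ud _ L_pos) (by norm_num)

lemma dU_has (hu : ContDiffOn ℝ 2 u (closure Omega)) {p : ℝ × ℝ} (hp : p ∈ strip (log 2)) :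
    HasFDerivWithinAt (fun p => u (cX p)) (dU u p) (strip (log 2)) p :=
  (((U_smooth hu).differentiableOn (by norm_num)) p hp).hasFDerivWithinAt

lemma dU_per (hu : ContDiffOn ℝ 2 u (closure Omega)) {t θ : ℝ} (ht : t ∈ Set.Icc 0 (log 2)) :
    dU u (t, θ + 2 * π) = dU u (t, θ) := by
  have h1 := dU_has hu (p := (t, θ + 2 * π)) ⟨ht, trivial⟩
  have h2 : HasFDerivWithinAt (fun p : ℝ × ℝ => (p.1, p.2 + 2 * π)) (ContinuousLinearMap.id ℝ (ℝ × ℝ)) (strip (log 2)) (t, θ) :=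
    ((hasFDerivAt_fst (𝕜 := ℝ) (p := ((t, θ) : ℝ × ℝ))).prodMk
      ((hasFDerivAt_snd (𝕜 := ℝ) (p := ((t, θ) : ℝ × ℝ))).add_const (2 * π))).hasFDerivWithinAt
  have h3 := HasFDerivWithinAt.comp (t, θ) (t := strip (log 2)) h1 h2 (fun q hq => ⟨hq.1, trivial⟩)
  rw [ContinuousLinearMap.comp_id] at h3
  have h4 : ((fun p => u (cX p)) ∘ fun p : ℝ × ℝ => (p.1, p.2 + 2 * π)) = fun p => u (cX p) := by
    funext p; simp only [Function.comp]; rw [cX_per]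
  rw [h4] at h3
  exact ((h3.fderivWithin (strip_ud _ L_pos _ ⟨ht, trivial⟩)).symm)

lemma dU_bd (hu : ContDiffOn ℝ 2 u (closure Omega)) {t : ℝ} (ht : t ∈ Set.Icc 0 (log 2))
    (h0 : ∀ θ, u (cX (t, θ)) = 0) (θ : ℝ) : dU u (t, θ) (0, 1) = 0 := by
  have h1 := dU_has hu (p := (t, θ)) ⟨ht, trivial⟩
  have h2 : HasDerivAt (fun s : ℝ => (t, s)) ((0:ℝ), (1:ℝ)) θ :=
    (hasDerivAt_const θ t).prodMk (hasDerivAt_id θ)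
  have h3 := h1.comp_hasDerivWithinAt (s := Set.univ) θ h2.hasDerivWithinAt (fun s _ => ⟨ht, trivial⟩)
  rw [hasDerivWithinAt_univ] at h3
  have h4 : ((fun p => u (cX p)) ∘ fun s : ℝ => (t, s)) = fun _ => 0 := by
    funext s; exact h0 s
  rw [h4] at h3
  exact h3.unique (hasDerivAt_const θ 0)

lemma strip_nhds {p : ℝ × ℝ} (hp : p.1 ∈ Set.Ioo 0 (log 2)) : strip (log 2) ∈ nhds p :=
  prod_mem_nhds (Icc_mem_nhds hp.1 hp.2) Filter.univ_mem

lemma u_at (hu : ContDiffOn ℝ 2 u (closure Omega)) {p : ℝ × ℝ} (hp : p.1 ∈ Set.Ioo 0 (log 2)) :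
    ContDiffAt ℝ 2 u (cX p) :=
  hu.contDiffAt (Filter.mem_of_superset (Omega_open.mem_nhds (cX_mem_Omega hp)) subset_closure)

lemma dU_eq (hu : ContDiffOn ℝ 2 u (closure Omega)) {p : ℝ × ℝ} (hp : p.1 ∈ Set.Ioo 0 (log 2)) :
    dU u p = (fderiv ℝ u (cX p)).comp
      ((ContinuousLinearMap.fst ℝ ℝ ℝ).smulRight (cX p) + (ContinuousLinearMap.snd ℝ ℝ ℝ).smulRight (cY p)) := by
  have h1 := (dU_has hu (p := p) (mem_of_mem_nhds (strip_nhds hp))).hasFDerivAt (strip_nhds hp)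
  have h2 := ((u_at hu hp).differentiableAt (by norm_num)).hasFDerivAt.comp p (hasFDerivAt_cX p)
  exact h1.unique h2

lemma near {p : ℝ × ℝ} (hp : p.1 ∈ Set.Ioo 0 (log 2)) : ∀ᶠ q : ℝ × ℝ in nhds p, q.1 ∈ Set.Ioo 0 (log 2) :=
  continuous_fst.continuousAt.preimage_mem_nhds (Ioo_mem_nhds hp.1 hp.2)

lemma sol_cyl (hβ : 0 < β ∧ β < 1/2) (ha : 0 < a) (hx : ‖x₀‖ = 1/2)
    (hV : LipschitzOnWith (Real.toNNReal (a / (2 * (1 + (2:ℝ) ^ (2 * β))))) V (closure Omega))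
    (hab : ∀ x ∈ closure Omega, a ≤ V x ∧ V x ≤ b) (hs : IsSolP β x₀ V u) :
    Cyl (log 2) (a / 4) 11 (fun p => u (cX p)) (fun p => dU u p (1, 0)) (fun p => dU u p (0, 1))
      (cK β x₀ V) := by
  obtain ⟨hu, hb, hpde⟩ := hs
  have b0 : ∀ θ, u (cX (0, θ)) = 0 := fun θ => hb _ (cX_frontier0 θ)
  have bL : ∀ θ, u (cX (log 2, θ)) = 0 := fun θ => hb _ (cX_frontierL θ)
  refine
  { hL := L_pos
    hk := by positivity
    cU := (U_smooth hu).continuousOn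
    ct := (dU_cont hu).clm_apply continuousOn_const
    ch := (dU_cont hu).clm_apply continuousOn_const
    cK := cK_cont ha hβ.1 hV
    dU := ?_
    d2 := ?_
    U0 := b0
    UL := bL
    h0 := fun θ => dU_bd hu ⟨le_rfl, L_pos.le⟩ b0 θ
    hhL := fun θ => dU_bd hu ⟨L_pos.le, le_rfl⟩ bL θ
    pU := fun t ht θ => by simp only [cX_per]
    pt := fun t ht θ => by simp only [dU_per hu ht]
    ph := fun t ht θ => by simp only [dU_per hu ht]
    kK := ?_
    mK := fun θ => cK_mono ha hβ.1 hx hV hab θ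
    aK := fun θ s t h1 h2 h3 => cK_growth ha hβ.1 hβ.2 hx hV hab θ s t h1 h2 h3 }
  · intro p hp
    have h1 := (dU_has hu (p := p) (mem_of_mem_nhds (strip_nhds hp))).hasFDerivAt (strip_nhds hp)
    refine h1.congr_fderiv ?_
    ext <;> simp
  · intro p hp
    have hsm := u_at hu hp
    have hsym : IsSymmSndFDerivAt ℝ u (cX p) := hsm.isSymmSndFDerivAt (by simp)
    have hG : HasFDerivAt (fun q => fderiv ℝ u (cX q)) ((fderiv ℝ (fderiv ℝ u) (cX p)).comp
      ((ContinuousLinearMap.fst ℝ ℝ ℝ).smulRight (cX p) + (ContinuousLinearMap.snd ℝ ℝ ℝ).smulRight (cY p))) p := by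
      have : DifferentiableAt ℝ (fderiv ℝ u) (cX p) :=
        (hsm.fderiv_right (m := 1) (by norm_num)).differentiableAt (by norm_num)
      exact this.hasFDerivAt.comp p (hasFDerivAt_cX p)
    have hlap := lap_eq u (cX p)
    have hp2 := hpde _ (cX_mem_Omega hp)
    have hbil := bil_sum (fderiv ℝ (fderiv ℝ u) (cX p)) p (fun v w => hsym v w)
    have hT := hG.clm_apply (hasFDerivAt_cX p)
    have hH := hG.clm_apply (hasFDerivAt_cY p)
    have eT : (fun q => dU u q (1, 0)) =ᶠ[nhds p] fun q => fderiv ℝ u (cX q) (cX q) := by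
      filter_upwards [near hp] with q hq
      rw [dU_eq hu hq]; simp
    have eH : (fun q => dU u q (0, 1)) =ᶠ[nhds p] fun q => fderiv ℝ u (cX q) (cY q) := by
      filter_upwards [near hp] with q hq
      rw [dU_eq hu hq]; simp
    have hXY : fderiv ℝ (fderiv ℝ u) (cX p) (cX p) (cY p) = fderiv ℝ (fderiv ℝ u) (cX p) (cY p) (cX p) := hsym _ _
    refine ⟨fderiv ℝ (fderiv ℝ u) (cX p) (cX p) (cX p) + fderiv ℝ u (cX p) (cX p),
      fderiv ℝ (fderiv ℝ u) (cX p) (cY p) (cX p) + fderiv ℝ u (cX p) (cY p),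
      fderiv ℝ (fderiv ℝ u) (cX p) (cY p) (cY p) - fderiv ℝ u (cX p) (cX p), ?_, ?_, ?_⟩
    · refine (hT.congr_of_eventuallyEq eT).congr_fderiv ?_
      ext <;> simp <;> ring
    · refine (hH.congr_of_eventuallyEq eH).congr_fderiv ?_
      ext <;> simp [hXY] <;> ring
    · unfold _root_.cK
      rw [hlap] at hp2
      linear_combination hbil - exp (2 * p.1) / 4 * hp2
  · intro p hp
    refine le_trans ?_ (cK_low ha hab p hp)
    have : 1 ≤ exp (2 * p.1) := one_le_exp (by linarith [hp.1.1])
    nlinarith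
end

section
variable {u : E2 → ℝ}

lemma pol_eq_cX {r : ℝ} (hr : 0 < r) (θ : ℝ) : pol r θ = cX (log (2 * r), θ) := by
  simp only [cX]
  rw [exp_log (by positivity)]
  congr 1; ring

lemma pol_mem_closure {r : ℝ} (h1 : 1/2 ≤ r) (h2 : r ≤ 1) (θ : ℝ) : pol r θ ∈ closure Omega := by
  rw [pol_eq_cX (by linarith)]
  refine cX_mem_closure ⟨⟨log_nonneg (by linarith), log_le_log (by linarith) (by linarith)⟩, trivial⟩

lemma pol_mem_iff {r : ℝ} (hr : 0 < r) (θ : ℝ) : pol r θ ∈ Omega ↔ r ∈ Set.Ioo (1/2) 1 := by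
  have : pol r θ ∈ Omega ↔ 1/2 < ‖pol r θ‖ ∧ ‖pol r θ‖ < 1 := Iff.rfl
  rw [this, norm_pol hr.le]; rfl

lemma int_polar (f : E2 → ℝ) : ∫ x, f x = ∫ p in polarCoord.target, p.1 * f (pol p.1 p.2) := by
  have h := (Complex.orthonormalBasisOneI.repr.measurePreserving).integral_comp
    Complex.orthonormalBasisOneI.repr.toHomeomorph.measurableEmbedding f
  rw [← h, ← Complex.integral_comp_polarCoord_symm]
  refine integral_congr_ae (Filter.Eventually.of_forall fun p => ?_)
  simp only [smul_eq_mul]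
  congr 2
  ext i
  rw [Complex.orthonormalBasisOneI_repr_apply, Complex.polarCoord_symm_apply]
  fin_cases i
  · simp [pol_0, Complex.cos_ofReal_re, Complex.sin_ofReal_re]
  · simp [pol_1, Complex.cos_ofReal_re, Complex.sin_ofReal_re]

lemma int_Omega1 (f : E2 → ℝ) : ∫ x in Omega, f x =
    ∫ p in Set.Ioo (1/2) 1 ×ˢ Set.Ioo (-π) π, p.1 * f (pol p.1 p.2) := by
  have hm : MeasurableSet (Set.Ioo (1/2:ℝ) 1 ×ˢ Set.Ioo (-π) π) := measurableSet_Ioo.prod measurableSet_Ioo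
  rw [← integral_indicator Omega_open.measurableSet, int_polar]
  have hs : Set.Ioo (1/2:ℝ) 1 ×ˢ Set.Ioo (-π) π ⊆ polarCoord.target :=
    Set.prod_mono (fun r hr => by have := hr.1; simp only [Set.mem_Ioi]; linarith) le_rfl
  rw [setIntegral_eq_of_subset_of_forall_diff_eq_zero (s := Set.Ioo (1/2:ℝ) 1 ×ˢ Set.Ioo (-π) π)
    polarCoord.open_target.measurableSet hs]
  · refine setIntegral_congr_fun hm ?_
    intro p hp
    have : pol p.1 p.2 ∈ Omega := (pol_mem_iff (by linarith [hp.1.1]) _).2 hp.1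
    simp only [Set.indicator_of_mem this]
  · rintro p ⟨h1, h2⟩
    have h3 : 0 < p.1 := h1.1
    have : pol p.1 p.2 ∉ Omega := fun h => h2 ⟨(pol_mem_iff h3 _).1 h, h1.2⟩
    rw [Set.indicator_of_notMem this, mul_zero]

lemma int_Omega2 (f : E2 → ℝ) (hf : ContinuousOn f (closure Omega)) : ∫ x in Omega, f x =
    ∫ r in Set.Icc (1/2:ℝ) 1, ∫ θ in (0:ℝ)..(2*π), r * f (pol r θ) := by
  have hpi := Real.pi_pos
  have hc : ContinuousOn (fun p : ℝ × ℝ => p.1 * f (pol p.1 p.2)) (Set.Icc (1/2:ℝ) 1 ×ˢ Set.Icc (-π) π) := by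
    refine continuousOn_fst.mul (hf.comp ?_ ?_)
    · have : Continuous (fun p : ℝ × ℝ => pol p.1 p.2) := by unfold pol; fun_prop
      exact this.continuousOn
    · exact fun p hp => pol_mem_closure hp.1.1 hp.1.2 _
  have hi : IntegrableOn (fun p : ℝ × ℝ => p.1 * f (pol p.1 p.2)) (Set.Ioo (1/2:ℝ) 1 ×ˢ Set.Ioo (-π) π) :=
    (hc.integrableOn_compact (isCompact_Icc.prod isCompact_Icc)).mono_set
      (Set.prod_mono Set.Ioo_subset_Icc_self Set.Ioo_subset_Icc_self)
  rw [int_Omega1]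
  rw [Measure.volume_eq_prod] at *
  rw [setIntegral_prod _ hi, integral_Icc_eq_integral_Ioo]
  refine setIntegral_congr_fun measurableSet_Ioo ?_
  intro r hr
  simp only
  rw [← integral_Ioc_eq_integral_Ioo, ← intervalIntegral.integral_of_le (by linarith)]
  have hp : Function.Periodic (fun θ => r * f (pol r θ)) (2 * π) := by
    intro θ; simp [pol]
  have := hp.intervalIntegral_add_eq (-π) 0
  rw [zero_add] at this
  rw [← this]; congr 1; ring

lemma img_exp : (fun t : ℝ => exp t / 2) '' Set.Icc 0 (log 2) = Set.Icc (1/2) 1 := by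
  ext r
  constructor
  · rintro ⟨t, ht, rfl⟩
    have h1 : 1 ≤ exp t := one_le_exp ht.1
    have h2 : exp t ≤ 2 := by rw [← exp_L]; exact exp_le_exp.2 ht.2
    constructor <;> simp only <;> linarith
  · rintro ⟨h1, h2⟩
    refine ⟨log (2 * r), ⟨log_nonneg (by linarith), log_le_log (by linarith) (by linarith)⟩, ?_⟩
    simp only
    rw [exp_log (by linarith)]; ring

lemma int_Omega3 (f : E2 → ℝ) (hf : ContinuousOn f (closure Omega)) : ∫ x in Omega, f x =
    ∫ p in bx 0 (log 2), exp (2 * p.1) / 4 * f (cX p) := by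
  have hc : ContinuousOn (fun p : ℝ × ℝ => exp (2 * p.1) / 4 * f (cX p)) (bx 0 (log 2)) := by
    have h3 : Continuous (fun p : ℝ × ℝ => exp (2 * p.1) / 4) := by fun_prop
    refine h3.continuousOn.mul (hf.comp cX_cont.continuousOn ?_)
    exact fun p hp => cX_mem_closure ⟨hp.1, trivial⟩
  rw [fub1 L_pos.le hc, int_Omega2 f hf, ← img_exp,
    integral_image_eq_integral_abs_deriv_smul (f' := fun t => exp t / 2) measurableSet_Icc
      (fun t _ => ((Real.hasDerivAt_exp t).div_const 2).hasDerivWithinAt)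
      (fun s _ t _ h => by
        exact exp_injective (by linarith))]
  refine setIntegral_congr_fun measurableSet_Icc ?_
  intro t _
  simp only [smul_eq_mul]
  rw [abs_of_pos (by positivity), ← intervalIntegral.integral_const_mul]
  congr 1
  funext θ
  have e1 : exp (2 * t) = exp t ^ 2 := by rw [← exp_nat_mul]; norm_num
  rw [e1]
  simp only [cX]
  ring
end

/-- **Theorem 1 (volume bound for (P))**: there is `c > 0` depending only on `a, b, β` such
that every classical solution of (P), with `a ≤ V ≤ b` Lipschitz with constant
`≤ a / (2 (1 + 2^{2β}))`, satisfies `∫_Ω e^u ≤ c`. -/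
theorem volume_bound_P (β a b : ℝ) (hβ : 0 < β ∧ β < 1/2) (ha : 0 < a) (hab : a ≤ b) :
    ∃ c > (0:ℝ), ∀ (x₀ : E2), ‖x₀‖ = 1/2 →
      ∀ V u : E2 → ℝ,
        LipschitzOnWith (Real.toNNReal (a / (2 * (1 + (2:ℝ) ^ (2 * β))))) V (closure Omega) →
        (∀ x ∈ closure Omega, a ≤ V x ∧ V x ≤ b) →
        IsSolP β x₀ V u →
        ∫ x in Omega, Real.exp (u x) ≤ c := by
  obtain ⟨M0, hM⟩ := Cyl.mass (log 2) (a / 4) 11 (by norm_num)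
  refine ⟨|M0| / a + 1, by positivity, ?_⟩
  intro x₀ hx V u hV hVab hs
  have hcyl := sol_cyl hβ ha hx hV hVab hs
  have hm := hM _ _ _ _ hcyl
  have hsub : bx 0 (log 2) ⊆ strip (log 2) := fun p hp => ⟨hp.1, trivial⟩
  have hu : ContinuousOn (fun x => exp (u x)) (closure Omega) := hs.1.continuousOn.rexp
  rw [int_Omega3 _ hu]
  have hE : ContinuousOn (fun p => exp (u (cX p))) (bx 0 (log 2)) := (hcyl.cU.mono hsub).rexp
  have h3 : Continuous (fun p : ℝ × ℝ => exp (2 * p.1) / 4) := by fun_prop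
  have i1 := bx_int (h3.continuousOn.mul hE)
  have i2 := bx_int (((hcyl.cK.mono hsub).mul hE).const_smul (1 / a))
  have hle : ∫ p in bx 0 (log 2), exp (2 * p.1) / 4 * exp (u (cX p)) ≤
      ∫ p in bx 0 (log 2), (1 / a) • (cK β x₀ V p * exp (u (cX p))) := by
    refine setIntegral_mono_on i1 i2 (bx_meas _ _) ?_
    intro p hp
    have := cK_low (β := β) (x₀ := x₀) ha hVab p (hsub hp)
    have h5 : exp (2 * p.1) / 4 ≤ 1 / a * cK β x₀ V p := by
      rw [one_div, inv_mul_eq_div, le_div_iff₀ ha]; exact this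
    calc exp (2 * p.1) / 4 * exp (u (cX p)) ≤ (1 / a * cK β x₀ V p) * exp (u (cX p)) := by gcongr
      _ = _ := by rw [smul_eq_mul]; ring
  refine hle.trans ?_
  rw [integral_smul, smul_eq_mul]
  have h6 : 1 / a * ∫ p in bx 0 (log 2), cK β x₀ V p * exp (u (cX p)) ≤ 1 / a * |M0| := by
    gcongr
    exact hm.trans (le_abs_self _)
  have h7 : 1 / a * |M0| = |M0| / a := by ring
  linarith
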